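/- arXiv:2402.16783 — 3 statements merged into one kernel-verified Lean document; each statement's English description precedes it below -/
import Mathlib

section
/- Let r > 0 and let P be the uniform distribution on the circle {(x₁,x₂) ∈ ℝ² : x₁² + x₂² = r²}. For every n ∈ ℕ with n ≥ 1, the set α_n = { (nr/π)·(sin(π/n)·cos((2j−1)π/n), sin(π/n)·sin((2j−1)π/n)) : j = 1, 2, …, n } forms an optimal set of n-means for P, and the n-th quantization error equals r²(1 − (n²/π²)·sin²(π/n)). -/
open MeasureTheory Set Filter

/-- The uniform distribution on the circle of radius `r` centered at the origin:
the pushforward of the normalized Lebesgue measure on `[0, 2π)` under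
`θ ↦ (r cos θ, r sin θ)`. -/
noncomputable def uniformCircle (r : ℝ) : Measure (ℝ × ℝ) :=
  Measure.map (fun θ : ℝ => (r * Real.cos θ, r * Real.sin θ))
    ((ENNReal.ofReal (2 * Real.pi))⁻¹ • volume.restrict (Set.Ico 0 (2 * Real.pi)))

/-- The squared Euclidean distance on `ℝ²`. -/
noncomputable def sqDist (p q : ℝ × ℝ) : ℝ := (p.1 - q.1) ^ 2 + (p.2 - q.2) ^ 2

/-- The distortion error of a set `s` of points for the measure `P` on `ℝ²`. -/
noncomputable def distortion2 (P : Measure (ℝ × ℝ)) (s : Set (ℝ × ℝ)) : ℝ :=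
  ∫ x, sInf (sqDist x '' s) ∂P

/-- The `n`-th (unconstrained, unconditional) quantization error for `P` on `ℝ²`. -/
noncomputable def quantError2 (P : Measure (ℝ × ℝ)) (n : ℕ) : ℝ :=
  sInf { v : ℝ | ∃ α : Set (ℝ × ℝ),
    α.Nonempty ∧ α.Finite ∧ α.ncard ≤ n ∧ v = distortion2 P α }

open Real in
theorem aux_h_nonpos {x : ℝ} (h0 : 0 ≤ x) (h1 : x ≤ π / 2) :
    2 * x ^ 2 * cos (2 * x) - 2 * x * sin (2 * x) + 1 - cos (2 * x) ≤ 0 := by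
  have key : AntitoneOn (fun x : ℝ => 2 * x ^ 2 * cos (2 * x) - 2 * x * sin (2 * x) + 1
      - cos (2 * x)) (Set.Icc 0 (π / 2)) := by
    refine antitoneOn_of_hasDerivWithinAt_nonpos (f' := fun x => -4 * x ^ 2 * sin (2 * x))
      (convex_Icc _ _) (by fun_prop) ?_ ?_
    · intro y _
      apply HasDerivAt.hasDerivWithinAt
      have h2 : HasDerivAt (fun x : ℝ => 2 * x) 2 y := by
        simpa using (hasDerivAt_id y).const_mul 2
      have hc := h2.cos
      have hs := h2.sin
      have hq : HasDerivAt (fun x : ℝ => 2 * x ^ 2) (4 * y) y := by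
        convert! (hasDerivAt_pow 2 y).const_mul 2 using 1
        push_cast; ring
      convert! (((hq.mul hc).sub (h2.mul hs)).add_const 1).sub hc using 1
      ring
    · intro y hy
      rw [interior_Icc] at hy
      have : 0 ≤ sin (2 * y) := sin_nonneg_of_nonneg_of_le_pi (by linarith [hy.1])
        (by linarith [hy.2])
      nlinarith [mul_nonneg (sq_nonneg y) this]
  have := key (show (0:ℝ) ∈ Set.Icc 0 (π / 2) from ⟨le_rfl, by positivity⟩) ⟨h0, h1⟩ h0
  simpa using this

/-- the derivative of `sin² x / x` -/
noncomputable def auxD (x : ℝ) : ℝ := 2 * Real.sin x * Real.cos x / x - Real.sin x ^ 2 / x ^ 2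

open Real in
theorem aux_hasDeriv {x : ℝ} (hx : 0 < x) :
    HasDerivAt (fun x : ℝ => sin x ^ 2 / x) (auxD x) x := by
  have h := ((hasDerivAt_sin x).pow 2).div (hasDerivAt_id x) hx.ne'
  convert! h using 1
  simp only [auxD, id, Pi.pow_apply]
  field_simp
  try ring

open Real in
theorem aux_hasDeriv2 {x : ℝ} (hx : 0 < x) :
    HasDerivAt auxD ((2 * x ^ 2 * cos (2 * x) - 2 * x * sin (2 * x) + 1 - cos (2 * x)) / x ^ 3)
      x := by
  have h := ((((hasDerivAt_sin x).const_mul 2).mul (hasDerivAt_cos x)).div (hasDerivAt_id x)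
    hx.ne').sub (((hasDerivAt_sin x).pow 2).div ((hasDerivAt_id x).pow 2)
      (by simpa using hx.ne'))
  convert! h using 1
  simp only [id, Pi.pow_apply, Pi.mul_apply]
  rw [cos_two_mul, sin_two_mul]
  field_simp
  have := sin_sq_add_cos_sq x
  push_cast
  have h2 : sin x ^ 2 = 1 - cos x ^ 2 := by linarith
  ring_nf
  simp only [h2]
  ring

open Real in
theorem aux_anti : AntitoneOn auxD (Set.Ioc 0 (π / 2)) := by
  refine antitoneOn_of_hasDerivWithinAt_nonpos (convex_Ioc _ _)
    (fun x hx => (aux_hasDeriv2 hx.1).continuousAt.continuousWithinAt)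
    (fun x hx => (aux_hasDeriv2 (interior_subset hx).1).hasDerivWithinAt) ?_
  intro x hx
  have hx := interior_subset hx
  exact div_nonpos_of_nonpos_of_nonneg (aux_h_nonpos hx.1.le hx.2) (pow_nonneg hx.1.le 3)

open Real in
theorem aux_conc : ConcaveOn ℝ (Set.Ioc 0 (π / 2)) (fun x : ℝ => sin x ^ 2 / x) := by
  refine concaveOn_of_hasDerivWithinAt2_nonpos (convex_Ioc _ _)
    (fun x hx => (aux_hasDeriv hx.1).continuousAt.continuousWithinAt)
    (fun x hx => (aux_hasDeriv (interior_subset hx).1).hasDerivWithinAt)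
    (fun x hx => (aux_hasDeriv2 (interior_subset hx).1).hasDerivWithinAt) ?_
  intro x hx
  have hx := interior_subset hx
  exact div_nonpos_of_nonpos_of_nonneg (aux_h_nonpos hx.1.le hx.2) (pow_nonneg hx.1.le 3)

/-- the intercept of the tangent line -/
noncomputable def auxA (x : ℝ) : ℝ := Real.sin x ^ 2 / x - x * auxD x

open Real in
theorem auxA_nonneg {x : ℝ} (h0 : 0 < x) (h1 : x ≤ π / 2) : 0 ≤ auxA x := by
  have h : x * cos x ≤ sin x := by
    rcases h1.lt_or_eq with h | h
    · have := le_tan h0.le h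
      have hc : 0 < cos x := cos_pos_of_mem_Ioo ⟨by linarith, h⟩
      rwa [tan_eq_sin_div_cos, le_div_iff₀ hc] at this
    · subst h; simp
  have hs : 0 ≤ sin x := sin_nonneg_of_nonneg_of_le_pi h0.le (by linarith [pi_pos])
  have e : auxA x = 2 * sin x * (sin x - x * cos x) / x := by
    unfold auxA auxD; field_simp; ring
  rw [e]
  have := sub_nonneg.2 h
  positivity

open Real in
theorem aux_tangent_small {u v : ℝ} (h0 : 0 < u) (h1 : u ≤ π / 2) (hv : 0 < v)
    (hv' : v ≤ π / 2) : sin v ^ 2 / v ≤ auxA u + auxD u * v := by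
  unfold auxA
  rcases lt_trichotomy u v with h | h | h
  · have := aux_conc.slope_le_of_hasDerivAt ⟨h0, h1⟩ ⟨hv, hv'⟩ h (aux_hasDeriv h0)
    rw [slope_def_field, div_le_iff₀ (by linarith)] at this
    linarith
  · subst h; linarith
  · have := aux_conc.le_slope_of_hasDerivAt ⟨hv, hv'⟩ ⟨h0, h1⟩ h (aux_hasDeriv h0)
    rw [slope_def_field, le_div_iff₀ (by linarith)] at this
    linarith

open Real in
theorem aux_tangent {u v : ℝ} (h0 : 0 < u) (h1 : u ≤ π / 2) (hv : 0 < v)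
    (hv' : v ≤ π) : sin v ^ 2 / v ≤ auxA u + auxD u * v := by
  rcases le_total v (π / 2) with h | h
  · exact aux_tangent_small h0 h1 hv h
  have hpi := pi_pos
  have a1 := aux_tangent_small (v := π / 2) h0 h1 (by positivity) le_rfl
  have a2 := aux_anti ⟨h0, h1⟩ (show π / 2 ∈ Set.Ioc 0 (π / 2) from ⟨by positivity, le_rfl⟩) h1
  have a3 : auxD (π / 2) = - (4 / π ^ 2) := by
    simp only [auxD, sin_pi_div_two, cos_pi_div_two]; field_simp; ring
  rw [a3] at a2
  rw [sin_pi_div_two] at a1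
  have a4 := mul_le_sin (x := v - π / 2) (by linarith) (by linarith)
  have a5 : sin (v - π / 2) ^ 2 = 1 - sin v ^ 2 := by
    rw [sin_sub_pi_div_two]; have := sin_sq_add_cos_sq v; linarith [neg_sq (cos v)]
  have a6 : (2 / π * (v - π / 2)) ^ 2 ≤ sin (v - π / 2) ^ 2 :=
    pow_le_pow_left₀ (mul_nonneg (by positivity) (by linarith)) a4 2
  rw [a5] at a6
  have a7 : sin v ^ 2 / v ≤ 4 / π ^ 2 * (π - v) := by
    rw [div_le_iff₀ hv]
    have : (2 / π * (v - π / 2)) ^ 2 = 1 - 4 / π ^ 2 * (π - v) * v := by field_simp; ring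
    linarith
  have a8 := mul_le_mul_of_nonneg_right a2 (sub_nonneg.2 h)
  have a9 : (1:ℝ) ^ 2 / (π / 2) = 4 / π ^ 2 * (π - π / 2) := by field_simp; ring
  nlinarith

open Real in
theorem aux_bathtub_total (φ c : ℝ) (h0 : 0 ≤ c) (h1 : c ≤ π) :
    ∫ θ in Set.Ico 0 (2 * π), max (cos (θ - φ) - cos c) 0 = 2 * sin c - 2 * c * cos c := by
  rw [integral_Ico_eq_integral_Ioc, ← intervalIntegral.integral_of_le (by positivity)]
  have hcont : Continuous (fun t : ℝ => max (cos t - cos c) 0) := by fun_prop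
  have hi : ∀ a b, IntervalIntegrable (fun t : ℝ => max (cos t - cos c) 0) volume a b :=
    fun a b => hcont.intervalIntegrable a b
  rw [intervalIntegral.integral_comp_sub_right (fun t => max (cos t - cos c) 0)]
  have hper : Function.Periodic (fun t : ℝ => max (cos t - cos c) 0) (2 * π) := by
    intro t; simp
  have := hper.intervalIntegral_add_eq (0 - φ) (-π)
  rw [show 2 * π - φ = 0 - φ + 2 * π by ring, this, show -π + 2 * π = π by ring,
    ← intervalIntegral.integral_add_adjacent_intervals (hi (-π) (-c)) (hi (-c) π),
    ← intervalIntegral.integral_add_adjacent_intervals (hi (-c) c) (hi c π)]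
  have e1 : ∫ t in (-π)..(-c), max (cos t - cos c) 0 = 0 := by
    rw [intervalIntegral.integral_congr (g := fun _ => (0:ℝ))]
    · simp
    intro t ht
    rw [Set.uIcc_of_le (by linarith)] at ht
    apply max_eq_right
    have := cos_le_cos_of_nonneg_of_le_pi (x := c) (y := -t) h0 (by linarith [ht.1])
      (by linarith [ht.2])
    rw [cos_neg] at this
    linarith
  have e3 : ∫ t in c..π, max (cos t - cos c) 0 = 0 := by
    rw [intervalIntegral.integral_congr (g := fun _ => (0:ℝ))]
    · simp
    intro t ht
    rw [Set.uIcc_of_le (by linarith)] at ht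
    apply max_eq_right
    have := cos_le_cos_of_nonneg_of_le_pi (x := c) (y := t) h0 ht.2 ht.1
    linarith
  have e2 : ∫ t in (-c)..c, max (cos t - cos c) 0 = 2 * sin c - 2 * c * cos c := by
    rw [intervalIntegral.integral_congr (g := fun t => cos t - cos c)]
    · rw [intervalIntegral.integral_sub (continuous_cos.intervalIntegrable _ _)
        (by simp)]
      simp
      ring
    intro t ht
    rw [Set.uIcc_of_le (by linarith)] at ht
    apply max_eq_left
    have := cos_le_cos_of_nonneg_of_le_pi (x := |t|) (y := c) (abs_nonneg _) h1
      (abs_le.2 ⟨ht.1, ht.2⟩)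
    rw [cos_abs] at this
    linarith
  rw [e1, e2, e3]; ring

theorem aux_integrableOn {f : ℝ → ℝ} (hf : Continuous f) {B : Set ℝ}
    (hB : B ⊆ Set.Ico 0 (2 * Real.pi)) : IntegrableOn f B :=
  (hf.integrableOn_Icc (a := 0) (b := 2 * Real.pi)).mono_set (hB.trans Set.Ico_subset_Icc_self)

open Real in
theorem aux_vol_le {B : Set ℝ} (hB : B ⊆ Set.Ico 0 (2 * π)) : volume.real B ≤ 2 * π := by
  have := measureReal_mono (μ := volume) hB measure_Ico_lt_top.ne
  rw [Real.volume_real_Ico_of_le (by positivity)] at this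
  linarith

open Real in
theorem aux_bathtub (φ : ℝ) {B : Set ℝ} (hB : B ⊆ Set.Ico 0 (2 * π)) :
    ∫ θ in B, cos (θ - φ) ≤ 2 * sin (volume.real B / 2) := by
  set c := volume.real B / 2 with hc
  have hc0 : 0 ≤ c := by positivity
  have hc1 : c ≤ π := by linarith [aux_vol_le hB]
  have h1 : ∫ θ in B, (cos (θ - φ) - cos c) ≤ ∫ θ in B, max (cos (θ - φ) - cos c) 0 :=
    integral_mono (aux_integrableOn (by fun_prop) hB) (aux_integrableOn (by fun_prop) hB)
      (fun θ => le_max_left _ _)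
  have h2 : ∫ θ in B, max (cos (θ - φ) - cos c) 0
      ≤ ∫ θ in Set.Ico 0 (2 * π), max (cos (θ - φ) - cos c) 0 := by
    apply setIntegral_mono_set (aux_integrableOn (by fun_prop) le_rfl)
    · exact Eventually.of_forall (fun θ => le_max_right _ _)
    · exact hB.eventuallyLE
  rw [aux_bathtub_total φ c hc0 hc1] at h2
  rw [integral_sub (aux_integrableOn (by fun_prop) hB) (aux_integrableOn (by fun_prop) hB),
    setIntegral_const, smul_eq_mul] at h1
  have : volume.real B = 2 * c := by rw [hc]; ring
  rw [this] at h1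
  linarith

open Real in
theorem aux_single (r : ℝ) (hr : 0 < r) (a : ℝ × ℝ) {B : Set ℝ}
    (hB : B ⊆ Set.Ico 0 (2 * π)) : ∃ ρ : ℝ, 0 ≤ ρ ∧
    (r ^ 2 + ρ ^ 2) * volume.real B - 4 * r * ρ * sin (volume.real B / 2)
      ≤ ∫ θ in B, sqDist (r * cos θ, r * sin θ) a := by
  obtain ⟨p, q⟩ := a
  set z : ℂ := ⟨p, q⟩ with hz
  have hp : ‖z‖ * cos z.arg = p := Complex.norm_mul_cos_arg z
  have hq : ‖z‖ * sin z.arg = q := Complex.norm_mul_sin_arg z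
  refine ⟨‖z‖, norm_nonneg _, ?_⟩
  have e : ∀ θ : ℝ, sqDist (r * cos θ, r * sin θ) (p, q)
      = (r ^ 2 + ‖z‖ ^ 2) - (2 * r * ‖z‖) * cos (θ - z.arg) := by
    intro θ
    rw [← hp, ← hq, cos_sub]
    simp only [sqDist]
    have h1 := sin_sq_add_cos_sq θ
    have h2 := sin_sq_add_cos_sq z.arg
    linear_combination r ^ 2 * h1 + ‖z‖ ^ 2 * h2
  simp_rw [e]
  rw [integral_sub (aux_integrableOn (by fun_prop) hB) (aux_integrableOn (by fun_prop) hB),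
    setIntegral_const, smul_eq_mul, integral_const_mul]
  have h := mul_le_mul_of_nonneg_left (aux_bathtub z.arg hB)
    (show 0 ≤ 2 * r * ‖z‖ by positivity)
  linarith

open Real in
theorem aux_single' (r : ℝ) (hr : 0 < r) (a : ℝ × ℝ) {u : ℝ} (h0 : 0 < u) (h1 : u ≤ π / 2)
    {B : Set ℝ} (hB : B ⊆ Set.Ico 0 (2 * π)) :
    r ^ 2 * volume.real B - (2 * r ^ 2 * auxA u + r ^ 2 * auxD u * volume.real B)
      ≤ ∫ θ in B, sqDist (r * cos θ, r * sin θ) a := by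
  obtain ⟨ρ, hρ, h⟩ := aux_single r hr a hB
  refine le_trans ?_ h
  have hv := aux_vol_le hB
  have hnn : 0 ≤ volume.real B := measureReal_nonneg
  set m := volume.real B
  rcases hnn.eq_or_lt with hm | hm
  · rw [← hm]
    have := auxA_nonneg h0 h1
    simp
    positivity
  · have ht := aux_tangent h0 h1 (v := m / 2) (by linarith) (by linarith)
    have h2 := mul_le_mul_of_nonneg_left ht (show 0 ≤ 2 * r ^ 2 by positivity)
    have h3 : 0 ≤ (r * sin (m / 2) / (m / 2) - ρ) ^ 2 * m := by positivity
    have h4 : (r * sin (m / 2) / (m / 2) - ρ) ^ 2 * m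
        = 2 * r ^ 2 * (sin (m / 2) ^ 2 / (m / 2)) - 4 * r * ρ * sin (m / 2) + ρ ^ 2 * m := by
      field_simp
      ring
    nlinarith

theorem aux_cont_sqDist (r : ℝ) (a : ℝ × ℝ) :
    Continuous (fun θ : ℝ => sqDist (r * Real.cos θ, r * Real.sin θ) a) := by
  unfold sqDist; fun_prop

theorem aux_cont_inf (r : ℝ) (s : Finset (ℝ × ℝ)) (hs : s.Nonempty) :
    Continuous (fun θ : ℝ => s.inf' hs (sqDist (r * Real.cos θ, r * Real.sin θ))) :=
  Continuous.finset_inf'_apply hs (fun a _ => aux_cont_sqDist r a)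

open Real in
theorem aux_many (r : ℝ) (hr : 0 < r) {u : ℝ} (h0 : 0 < u) (h1 : u ≤ π / 2)
    (s : Finset (ℝ × ℝ)) (hs : s.Nonempty) :
    ∀ B : Set ℝ, MeasurableSet B → B ⊆ Set.Ico 0 (2 * π) →
    r ^ 2 * volume.real B - (s.card * (2 * r ^ 2 * auxA u) + r ^ 2 * auxD u * volume.real B)
      ≤ ∫ θ in B, s.inf' hs (sqDist (r * cos θ, r * sin θ)) := by
  induction hs using Finset.Nonempty.cons_induction with
  | singleton a =>
    intro B _ hB
    simpa using aux_single' r hr a h0 h1 hB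
  | cons a s ha hs ih =>
    intro B hBm hB
    have c1 := aux_cont_sqDist r a
    have c2 := aux_cont_inf r s hs
    have c3 := aux_cont_inf r (Finset.cons a s ha) (Finset.cons_nonempty ha)
    set S : Set ℝ := {θ | sqDist (r * cos θ, r * sin θ) a
      ≤ s.inf' hs (sqDist (r * cos θ, r * sin θ))} with hS
    have hSm : MeasurableSet S := (isClosed_le c1 c2).measurableSet
    have hB1 : B ∩ S ⊆ Set.Ico 0 (2 * π) := Set.inter_subset_left.trans hB
    have hB2 : B \ S ⊆ Set.Ico 0 (2 * π) := Set.diff_subset.trans hB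
    have i1 := aux_single' r hr a h0 h1 hB1
    have i2 := ih (B \ S) (hBm.diff hSm) hB2
    have v := measureReal_inter_add_diff (μ := volume) (s := B) hSm
      (((measure_mono hB).trans_lt measure_Ico_lt_top).ne)
    have w := integral_inter_add_diff (μ := volume) (s := B) hSm (aux_integrableOn c3 hB)
    have e1 : ∫ θ in B ∩ S, (Finset.cons a s ha).inf' (Finset.cons_nonempty ha)
        (sqDist (r * cos θ, r * sin θ)) = ∫ θ in B ∩ S, sqDist (r * cos θ, r * sin θ) a := by
      apply setIntegral_congr_fun (hBm.inter hSm)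
      intro θ hθ
      have : sqDist (r * cos θ, r * sin θ) a
        ≤ s.inf' hs (sqDist (r * cos θ, r * sin θ)) := hθ.2
      simp only [Finset.inf'_cons hs]
      exact inf_eq_left.2 this
    have e2 : ∫ θ in B \ S, (Finset.cons a s ha).inf' (Finset.cons_nonempty ha)
        (sqDist (r * cos θ, r * sin θ))
        = ∫ θ in B \ S, s.inf' hs (sqDist (r * cos θ, r * sin θ)) := by
      apply setIntegral_congr_fun (hBm.diff hSm)
      intro θ hθ
      have : ¬ (sqDist (r * cos θ, r * sin θ) a
        ≤ s.inf' hs (sqDist (r * cos θ, r * sin θ))) := hθ.2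
      simp only [Finset.inf'_cons hs]
      exact inf_eq_right.2 (not_le.1 this).le
    rw [← w, e1, e2, ← v, Finset.card_cons]
    push_cast
    linarith

open Real in
theorem aux_distortion (r : ℝ) (s : Finset (ℝ × ℝ)) (hs : s.Nonempty) :
    distortion2 (uniformCircle r) (s : Set (ℝ × ℝ))
      = (2 * π)⁻¹ * ∫ θ in Set.Ico 0 (2 * π), s.inf' hs (sqDist (r * cos θ, r * sin θ)) := by
  unfold distortion2 uniformCircle
  simp_rw [← Finset.inf'_eq_csInf_image s hs]
  have hc : Continuous (fun x : ℝ × ℝ => s.inf' hs (sqDist x)) := by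
    refine Continuous.finset_inf'_apply hs (fun a _ => ?_)
    unfold sqDist; fun_prop
  rw [integral_map (by fun_prop) hc.aestronglyMeasurable, integral_smul_measure]
  rw [ENNReal.toReal_inv, ENNReal.toReal_ofReal (by positivity), smul_eq_mul]

open Real in
theorem aux_lower (r : ℝ) (hr : 0 < r) (n : ℕ) (hn : 1 ≤ n) (s : Finset (ℝ × ℝ))
    (hs : s.Nonempty) (hcard : s.card ≤ n) :
    r ^ 2 * (1 - (n : ℝ) ^ 2 / π ^ 2 * sin (π / n) ^ 2)
      ≤ distortion2 (uniformCircle r) (s : Set (ℝ × ℝ)) := by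
  have hpi := pi_pos
  rw [aux_distortion r s hs, ← div_eq_inv_mul, le_div_iff₀ (by positivity)]
  have hvol : volume.real (Set.Ico 0 (2 * π)) = 2 * π := by
    rw [Real.volume_real_Ico_of_le (by positivity), sub_zero]
  rcases hn.eq_or_lt with h | h
  · subst h
    obtain ⟨a, rfl⟩ := Finset.card_eq_one.1 (le_antisymm hcard hs.card_pos)
    obtain ⟨ρ, hρ, h⟩ := aux_single r hr a (B := Set.Ico 0 (2 * π)) le_rfl
    rw [hvol, show 2 * π / 2 = π by ring, sin_pi] at h
    simp only [Finset.inf'_singleton]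
    refine le_trans ?_ h
    simp
    nlinarith [mul_nonneg (sq_nonneg ρ) hpi.le]
  · have hn2 : (2:ℝ) ≤ n := by exact_mod_cast h
    have hn0 : (0:ℝ) < n := by linarith
    have h0 : 0 < π / n := by positivity
    have h1 : π / n ≤ π / 2 := div_le_div_of_nonneg_left hpi.le (by norm_num) hn2
    have key := aux_many r hr h0 h1 s hs (Set.Ico 0 (2 * π)) measurableSet_Ico le_rfl
    refine le_trans ?_ key
    rw [hvol]
    have hA := auxA_nonneg h0 h1
    have hk : (s.card : ℝ) ≤ n := by exact_mod_cast hcard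
    have := mul_le_mul_of_nonneg_right hk (show 0 ≤ 2 * r ^ 2 * auxA (π / n) by positivity)
    have e : (n : ℝ) * (2 * r ^ 2 * auxA (π / n)) + r ^ 2 * auxD (π / n) * (2 * π)
        = r ^ 2 * ((n : ℝ) ^ 2 / π ^ 2 * sin (π / n) ^ 2) * (2 * π) := by
      unfold auxA; field_simp; ring
    linarith

/-- the optimal points -/
noncomputable def auxPt (r : ℝ) (n j : ℕ) : ℝ × ℝ :=
  ((n : ℝ) * r / Real.pi *
      (Real.sin (Real.pi / n) * Real.cos ((2 * (j : ℝ) - 1) * Real.pi / n)),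
   (n : ℝ) * r / Real.pi *
      (Real.sin (Real.pi / n) * Real.sin ((2 * (j : ℝ) - 1) * Real.pi / n)))

open Real in
theorem aux_upper (r : ℝ) (n : ℕ) (hn : 1 ≤ n) (s : Finset (ℝ × ℝ))
    (hs : s.Nonempty) (hmem : ∀ j ∈ Set.Icc 1 n, auxPt r n j ∈ s) :
    distortion2 (uniformCircle r) (s : Set (ℝ × ℝ))
      ≤ r ^ 2 * (1 - (n : ℝ) ^ 2 / π ^ 2 * sin (π / n) ^ 2) := by
  have hpi := pi_pos
  have hn0 : (0:ℝ) < n := by exact_mod_cast hn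
  rw [aux_distortion r s hs, ← div_eq_inv_mul, div_le_iff₀ (by positivity),
    integral_Ico_eq_integral_Ioc, ← intervalIntegral.integral_of_le (by positivity)]
  have hc := aux_cont_inf r s hs
  have hsum := intervalIntegral.sum_integral_adjacent_intervals (μ := volume)
    (a := fun k : ℕ => 2 * π * k / n) (n := n) (fun k _ => hc.intervalIntegrable _ _)
  simp only [Nat.cast_zero, mul_zero, zero_div] at hsum
  rw [mul_div_cancel_right₀ _ hn0.ne'] at hsum
  rw [← hsum]
  set ρ : ℝ := n * r / π * sin (π / n) with hρ
  have hk : ∀ k ∈ Finset.range n,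
      ∫ θ in (2 * π * (k : ℕ) / n)..(2 * π * (k + 1 : ℕ) / n),
        s.inf' hs (sqDist (r * cos θ, r * sin θ))
      ≤ (r ^ 2 + ρ ^ 2) * (2 * π / n) - 4 * r * ρ * sin (π / n) := by
    intro k hk
    rw [Finset.mem_range] at hk
    have hle : 2 * π * (k : ℕ) / n ≤ 2 * π * (k + 1 : ℕ) / n := by
      push_cast; gcongr; linarith
    have hm := hmem (k + 1) ⟨by omega, by omega⟩
    refine (intervalIntegral.integral_mono_on hle (hc.intervalIntegrable _ _)
      ((aux_cont_sqDist r (auxPt r n (k + 1))).intervalIntegrable _ _)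
      (fun θ _ => Finset.inf'_le _ hm)).trans ?_
    set ψ : ℝ := (2 * ((k + 1 : ℕ) : ℝ) - 1) * π / n with hψ
    have e : ∀ θ : ℝ, sqDist (r * cos θ, r * sin θ) (auxPt r n (k + 1))
        = (r ^ 2 + ρ ^ 2) - (2 * r * ρ) * cos (θ - ψ) := by
      intro θ
      rw [cos_sub]
      simp only [sqDist, auxPt]
      rw [← hψ, ← mul_assoc, ← mul_assoc, ← hρ]
      have h1 := sin_sq_add_cos_sq θ
      have h2 := sin_sq_add_cos_sq ψ
      linear_combination r ^ 2 * h1 + ρ ^ 2 * h2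
    simp_rw [e]
    have c : Continuous fun θ : ℝ => (2 * r * ρ) * cos (θ - ψ) := by fun_prop
    rw [intervalIntegral.integral_sub (by simp) (c.intervalIntegrable _ _),
      intervalIntegral.integral_const, intervalIntegral.integral_const_mul,
      intervalIntegral.integral_comp_sub_right (fun t => cos t), integral_cos]
    have e1 : 2 * π * (k + 1 : ℕ) / n - ψ = π / n := by
      rw [hψ]; push_cast; field_simp; ring
    have e2 : 2 * π * (k : ℕ) / n - ψ = - (π / n) := by
      rw [hψ]; push_cast; field_simp; ring
    rw [e1, e2, sin_neg, smul_eq_mul]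
    have e3 : 2 * π * (k + 1 : ℕ) / n - 2 * π * (k : ℕ) / n = 2 * π / n := by
      push_cast; field_simp; ring
    rw [e3]
    apply le_of_eq; ring
  refine (Finset.sum_le_sum hk).trans (le_of_eq ?_)
  rw [Finset.sum_const, Finset.card_range, nsmul_eq_mul, hρ]
  field_simp
  ring

/-- Theorem 3.7: the optimal sets of `n`-means and the `n`-th quantization errors for the
uniform distribution on the circle of radius `r`. -/
theorem stmt10 (r : ℝ) (hr : 0 < r) (n : ℕ) (hn : 1 ≤ n) :
    quantError2 (uniformCircle r) n
      = r ^ 2 * (1 - (n : ℝ) ^ 2 / Real.pi ^ 2 * Real.sin (Real.pi / n) ^ 2)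
    ∧ distortion2 (uniformCircle r)
        ((fun j : ℕ =>
          ((n : ℝ) * r / Real.pi *
              (Real.sin (Real.pi / n) * Real.cos ((2 * (j : ℝ) - 1) * Real.pi / n)),
           (n : ℝ) * r / Real.pi *
              (Real.sin (Real.pi / n) * Real.sin ((2 * (j : ℝ) - 1) * Real.pi / n)))) ''
          Set.Icc 1 n)
      = r ^ 2 * (1 - (n : ℝ) ^ 2 / Real.pi ^ 2 * Real.sin (Real.pi / n) ^ 2) := by
  have hfin : (auxPt r n '' Set.Icc 1 n).Finite := (Set.finite_Icc 1 n).image _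
  have hne : (auxPt r n '' Set.Icc 1 n).Nonempty := ⟨_, 1, ⟨le_rfl, hn⟩, rfl⟩
  have hcard : (auxPt r n '' Set.Icc 1 n).ncard ≤ n := by
    refine (Set.ncard_image_le (Set.finite_Icc 1 n)).trans ?_
    rw [← Finset.coe_Icc, Set.ncard_coe_finset, Nat.card_Icc]
    omega
  have lower : ∀ α : Set (ℝ × ℝ), α.Nonempty → α.Finite → α.ncard ≤ n →
      r ^ 2 * (1 - (n : ℝ) ^ 2 / Real.pi ^ 2 * Real.sin (Real.pi / n) ^ 2)
        ≤ distortion2 (uniformCircle r) α := by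
    intro α h1 h2 h3
    lift α to Finset (ℝ × ℝ) using h2
    rw [Set.ncard_coe_finset] at h3
    exact aux_lower r hr n hn α (by simpa using h1) h3
  have main : distortion2 (uniformCircle r) (auxPt r n '' Set.Icc 1 n)
      = r ^ 2 * (1 - (n : ℝ) ^ 2 / Real.pi ^ 2 * Real.sin (Real.pi / n) ^ 2) := by
    refine le_antisymm ?_ (lower _ hne hfin hcard)
    have := aux_upper r n hn hfin.toFinset (by simpa using hne)
      (fun j hj => by rw [Set.Finite.mem_toFinset]; exact ⟨j, hj, rfl⟩)
    rwa [Set.Finite.coe_toFinset] at this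
  refine ⟨?_, main⟩
  apply IsLeast.csInf_eq
  refine ⟨⟨_, hne, hfin, hcard, main.symm⟩, ?_⟩
  rintro v ⟨α, h1, h2, h3, rfl⟩
  exact lower α h1 h2 h3
end

section
/- Let m ≥ 3, r > 0, let A_j = (r cos(2π(j−1)/m), r sin(2π(j−1)/m)) for 1 ≤ j ≤ m+1 (so A_{m+1} = A_1), and let P be the uniform distribution on the boundary of the regular m-sided polygon A_1A_2⋯A_m. Let k ≥ 1 and n = mk. Then the n-th conditional unconstrained quantization error for P with respect to the conditional set β = {A_j : 1 ≤ j ≤ m} equals r² sin²(π/m)/(3k²), and this infimum is attained by the set α_n = ⋃_{j=1}^{m} { A_j + ((i−1)/k)(A_{j+1} − A_j) : 1 ≤ i ≤ k+1 }. -/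
open MeasureTheory Set Filter

/-- The uniform distribution on `[a, b]`: normalized Lebesgue measure restricted to `[a, b]`. -/
noncomputable def uniformOn (a b : ℝ) : Measure ℝ :=
  (ENNReal.ofReal (b - a))⁻¹ • volume.restrict (Set.Icc a b)

/-- The `j`-th vertex `A_j = (r cos(2π(j-1)/m), r sin(2π(j-1)/m))` of the regular `m`-sided
polygon inscribed in the circle of radius `r` centered at the origin. -/
noncomputable def vtx (m : ℕ) (r : ℝ) (j : ℕ) : ℝ × ℝ :=
  (r * Real.cos (2 * Real.pi * ((j : ℝ) - 1) / m),
   r * Real.sin (2 * Real.pi * ((j : ℝ) - 1) / m))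

/-- The uniform distribution on the boundary of the regular `m`-sided polygon
`A_1 A_2 ⋯ A_m` inscribed in the circle of radius `r` centered at the origin:
`P = (1/m) Σ_{j=1}^m` (pushforward of the uniform distribution on `[0,1]` under
`t ↦ (1-t)A_j + tA_{j+1}`). -/
noncomputable def polyUniform (m : ℕ) (r : ℝ) : Measure (ℝ × ℝ) :=
  (m : ENNReal)⁻¹ • ∑ j ∈ Finset.Icc 1 m,
    Measure.map (fun t : ℝ => (1 - t) • vtx m r j + t • vtx m r (j + 1)) (uniformOn 0 1)

/-- The `n`-th conditional (unconstrained) quantization error for `P` on `ℝ²` with respect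
to the conditional set `β`. -/
noncomputable def condQuantError2 (P : Measure (ℝ × ℝ)) (β : Set (ℝ × ℝ)) (n : ℕ) : ℝ :=
  sInf { v : ℝ | ∃ α : Set (ℝ × ℝ),
    α.Finite ∧ α.ncard ≤ n - β.ncard ∧ v = distortion2 P (α ∪ β) }




theorem int_extend (f : ℝ → ℝ) (hf : Continuous f) (h0 : ∀ y, 0 ≤ f y) (a b c d : ℝ)
    (hab : a ≤ b) (_hcd : c ≤ d) (hl : ∀ y, a ≤ y → y < c → f y ≤ 0) (hu : ∀ y, d ≤ y → f y ≤ 0) :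
    ∫ y in a..b, f y ≤ ∫ y in c..d, f y := by
  have hi : ∀ u v, IntervalIntegrable f volume u v := fun u v => hf.intervalIntegrable u v
  have h1 : ∫ y in a..b, f y ≤ ∫ y in (min a c)..(max b d), f y := by
    apply intervalIntegral.integral_mono_interval (min_le_left _ _) hab (le_max_left _ _)
    · exact Eventually.of_forall h0
    · exact hi _ _
  by_cases hac : a ≤ c
  · rw [min_eq_left hac] at h1
    rw [← intervalIntegral.integral_add_adjacent_intervals (hi a c) (hi c (max b d)),
      ← intervalIntegral.integral_add_adjacent_intervals (hi c d) (hi d (max b d))] at h1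
    have e1 : ∫ y in a..c, f y ≤ ∫ y in a..c, (0:ℝ) :=
      intervalIntegral.integral_mono_on_of_le_Ioo hac (hi _ _) (by simp) (fun y hy => hl y hy.1.le hy.2)
    have e2 : ∫ y in d..(max b d), f y ≤ ∫ y in d..(max b d), (0:ℝ) :=
      intervalIntegral.integral_mono_on (le_max_right _ _) (hi _ _) (by simp) (fun y hy => hu y hy.1)
    simp at e1 e2
    linarith
  · push Not at hac
    rw [min_eq_right hac.le] at h1
    rw [← intervalIntegral.integral_add_adjacent_intervals (hi c d) (hi d (max b d))] at h1
    have e2 : ∫ y in d..(max b d), f y ≤ ∫ y in d..(max b d), (0:ℝ) :=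
      intervalIntegral.integral_mono_on (le_max_right _ _) (hi _ _) (by simp) (fun y hy => hu y hy.1)
    simp at e2
    linarith

theorem int_quad (w e a b : ℝ) :
    ∫ y in a..b, (w ^ 2 - (y - e) ^ 2) =
      (w ^ 2 * (b - e) - (b - e) ^ 3 / 3) - (w ^ 2 * (a - e) - (a - e) ^ 3 / 3) := by
  have := intervalIntegral.integral_comp_sub_right (a := a) (b := b) (fun y => w ^ 2 - y ^ 2) e
  rw [this, intervalIntegral.integral_sub (by simp) (by simp), integral_pow]
  simp
  ring

theorem int_quad_pos (w e a b : ℝ) (hw : 0 ≤ w) (hab : a ≤ b) :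
    ∫ y in a..b, max (w ^ 2 - (y - e) ^ 2) 0 ≤ 4 / 3 * w ^ 3 := by
  have h := int_extend (fun y => max (w ^ 2 - (y - e) ^ 2) 0) (by fun_prop)
    (fun y => le_max_right _ _) a b (e - w) (e + w) hab (by linarith)
    (fun y _ hy => by simp; nlinarith) (fun y hy => by simp; nlinarith)
  refine h.trans ?_
  have : ∫ y in (e-w)..(e+w), max (w ^ 2 - (y - e) ^ 2) 0 ≤ ∫ y in (e-w)..(e+w), (w ^ 2 - (y - e) ^ 2) :=
    intervalIntegral.integral_mono_on (by linarith)
      (Continuous.intervalIntegrable (by fun_prop) _ _) (Continuous.intervalIntegrable (by fun_prop) _ _)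
      (fun y hy => by rw [max_eq_left]; nlinarith [hy.1, hy.2])
  rw [int_quad] at this
  linarith [this]

theorem int_quad_pos_half (w e a b : ℝ) (hw : 0 ≤ w) (hab : a ≤ b) (he : e ≤ a) :
    ∫ y in a..b, max (w ^ 2 - (y - e) ^ 2) 0 ≤ 2 / 3 * w ^ 3 := by
  have h := int_extend (fun y => max (w ^ 2 - (y - e) ^ 2) 0) (by fun_prop)
    (fun y => le_max_right _ _) a b e (e + w) hab (by linarith)
    (fun y h1 hy => absurd hy (by linarith)) (fun y hy => by simp; nlinarith)
  · refine h.trans ?_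
    have : ∫ y in e..(e+w), max (w ^ 2 - (y - e) ^ 2) 0 ≤ ∫ y in e..(e+w), (w ^ 2 - (y - e) ^ 2) :=
      intervalIntegral.integral_mono_on (by linarith)
        (Continuous.intervalIntegrable (by fun_prop) _ _) (Continuous.intervalIntegrable (by fun_prop) _ _)
        (fun y hy => by rw [max_eq_left]; nlinarith [hy.1, hy.2])
    rw [int_quad] at this
    linarith [this]

/-- normalised gain -/
noncomputable def gn (d p y : ℝ) : ℝ := max (min 1 (y ^ 2) - (y ^ 2 - 2 * y * p + d ^ 2)) 0

theorem gn_cont (d p : ℝ) : Continuous (gn d p) := by unfold gn; fun_prop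

theorem gn_le (d p q y H : ℝ) (hy : 0 ≤ y) (hp : p ≤ d) (hq : q ≤ d)
    (hpq : p + q ≤ √3 * d) (h0 : 0 ≤ H) (h1 : min 1 (y ^ 2) - (y - d) ^ 2 ≤ H)
    (h2 : 2 * min 1 (y ^ 2) - 2 * (y ^ 2 + d ^ 2 - √3 * (y * d)) ≤ H) :
    gn d p y + gn d q y ≤ H := by
  have a1 : y * p ≤ y * d := mul_le_mul_of_nonneg_left hp hy
  have a2 : y * q ≤ y * d := mul_le_mul_of_nonneg_left hq hy
  have a3 : y * (p + q) ≤ y * (√3 * d) := mul_le_mul_of_nonneg_left hpq hy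
  unfold gn
  rcases max_cases (min 1 (y ^ 2) - (y ^ 2 - 2 * y * p + d ^ 2)) 0 with ⟨e, _⟩ | ⟨e, _⟩ <;>
  rcases max_cases (min 1 (y ^ 2) - (y ^ 2 - 2 * y * q + d ^ 2)) 0 with ⟨e', _⟩ | ⟨e', _⟩ <;>
  rw [e, e'] <;> nlinarith

set_option maxHeartbeats 1600000 in
theorem core (d p q T : ℝ) (hd : 0 ≤ d) (hT : 0 ≤ T) (hp : p ≤ d) (hq : q ≤ d)
    (hpq : p + q ≤ √3 * d) :
    ∫ y in (0:ℝ)..T, (gn d p y + gn d q y) ≤ 4 / 3 := by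
  have s3 : √3 ^ 2 = 3 := Real.sq_sqrt (by norm_num)
  have s0 : 0 ≤ √3 := Real.sqrt_nonneg 3
  have s1 : √3 ≤ 1.733 := by nlinarith
  have hc : Continuous (fun y => gn d p y + gn d q y) := (gn_cont d p).add (gn_cont d q)
  have hi : ∀ u v, IntervalIntegrable (fun y => gn d p y + gn d q y) volume u v :=
    fun u v => hc.intervalIntegrable u v
  have h0 : ∀ y, 0 ≤ gn d p y + gn d q y := fun y => add_nonneg (le_max_right _ _) (le_max_right _ _)
  have key := fun y H hy => gn_le d p q y H hy hp hq hpq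
  rcases le_total d 1 with hd1 | hd1
  · -- d ≤ 1
    refine (int_extend _ hc h0 0 T 0 2 hT (by norm_num) (fun y h1 h2 => ?_) (fun y hy => ?_)).trans ?_
    · exact absurd h2 (by linarith)
    · have hm : min 1 (y ^ 2) ≤ 1 := min_le_left _ _
      apply key y 0 (by linarith) le_rfl
      · nlinarith
      · nlinarith [sq_nonneg (√3 * y - 2 * d)]
    · rw [← intervalIntegral.integral_add_adjacent_intervals (hi 0 1) (hi 1 2)]
      have e1 : ∫ y in (0:ℝ)..1, (gn d p y + gn d q y) ≤ ∫ y in (0:ℝ)..1, (3/2 * y ^ 2) := by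
        apply intervalIntegral.integral_mono_on (by norm_num) (hi _ _)
          (Continuous.intervalIntegrable (by fun_prop) _ _)
        intro y hy
        have hm : min 1 (y ^ 2) ≤ y ^ 2 := min_le_right _ _
        apply key y _ hy.1 (by positivity)
        · nlinarith [sq_nonneg (y - d)]
        · nlinarith [sq_nonneg (√3 * y - 2 * d)]
      have e2 : ∫ y in (1:ℝ)..2, (gn d p y + gn d q y) ≤ ∫ y in (1:ℝ)..2, (2 - 1/2 * y ^ 2) := by
        apply intervalIntegral.integral_mono_on (by norm_num) (hi _ _)
          (Continuous.intervalIntegrable (by fun_prop) _ _)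
        intro y hy
        have hm : min 1 (y ^ 2) ≤ 1 := min_le_left _ _
        apply key y _ (by linarith [hy.1]) (by nlinarith [hy.1, hy.2])
        · nlinarith [sq_nonneg (y - 2 * d)]
        · nlinarith [sq_nonneg (√3 * y - 2 * d)]
      have v1 : ∫ y in (0:ℝ)..1, (3/2 * y ^ 2) = 1 / 2 := by
        rw [intervalIntegral.integral_const_mul, integral_pow]; norm_num
      have v2 : ∫ y in (1:ℝ)..2, (2 - 1/2 * y ^ 2) = 5 / 6 := by
        rw [intervalIntegral.integral_sub (by simp) (Continuous.intervalIntegrable (by fun_prop) _ _),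
          intervalIntegral.integral_const_mul, integral_pow]; norm_num
      linarith
  rcases le_total (3/2) d with hd2 | hd2
  · -- 3/2 ≤ d
    refine le_trans ?_ ((int_quad_pos 1 d 0 T zero_le_one hT).trans (by norm_num))
    apply intervalIntegral.integral_mono_on hT (hi _ _)
      (Continuous.intervalIntegrable (by fun_prop) _ _)
    intro y hy
    have hm : min 1 (y ^ 2) ≤ 1 := min_le_left _ _
    have hyd : √3 * (y * d) ≤ 1.733 * (y * d) :=
      mul_le_mul_of_nonneg_right s1 (mul_nonneg hy.1 hd)
    apply key y _ hy.1 (le_max_right _ _)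
    · refine le_trans ?_ (le_max_left _ _); nlinarith
    · refine le_trans ?_ (le_max_left _ _); nlinarith [sq_nonneg (y - 0.733 * d)]
  · -- 1 ≤ d ≤ 3/2
    have hyd : ∀ y, 0 ≤ y → √3 * (y * d) ≤ 7/4 * (y * d) := fun y hy =>
      mul_le_mul_of_nonneg_right (by linarith) (mul_nonneg hy hd)
    obtain ⟨w, hw, hw2⟩ : ∃ w : ℝ, 0 ≤ w ∧ w ^ 2 = 1 - 7/16 * d ^ 2 :=
      ⟨√(1 - 7/16 * d ^ 2), Real.sqrt_nonneg _, Real.sq_sqrt (by nlinarith)⟩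
    refine (int_extend _ hc h0 0 T (d/2) (5/2) hT (by linarith) (fun y h1 h2 => ?_) (fun y hy => ?_)).trans ?_
    · have hm : min 1 (y ^ 2) ≤ y ^ 2 := min_le_right _ _
      have := hyd y h1
      apply key y 0 h1 le_rfl
      · nlinarith
      · nlinarith
    · have hm : min 1 (y ^ 2) ≤ 1 := min_le_left _ _
      apply key y 0 (by linarith) le_rfl
      · nlinarith
      · nlinarith [sq_nonneg (√3 * y - 2 * d)]
    rw [← intervalIntegral.integral_add_adjacent_intervals (hi (d/2) 1) (hi 1 (5/2))]
    have hpos : 0 < 1 - d / 2 := by linarith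
    have e1 : ∫ y in (d/2)..1, (gn d p y + gn d q y) ≤
        ∫ y in (d/2)..1, (2 * d * (7/4 - d) / (1 - d / 2)) * (y - d/2) := by
      apply intervalIntegral.integral_mono_on (by linarith) (hi _ _)
        (Continuous.intervalIntegrable (by fun_prop) _ _)
      intro y hy
      have hm : min 1 (y ^ 2) ≤ y ^ 2 := min_le_right _ _
      have hy0 : 0 ≤ y := by linarith [hy.1]
      have := hyd y hy0
      have hY : 0 ≤ y - d / 2 := by linarith [hy.1]
      apply key y _ hy0
      · apply mul_nonneg _ hY
        apply div_nonneg _ hpos.le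
        nlinarith
      · rw [div_mul_eq_mul_div, le_div_iff₀ hpos]
        have h1 : min 1 (y ^ 2) - (y - d) ^ 2 ≤ 2 * d * (y - d/2) := by nlinarith
        have h2 : 2 * d * (y - d/2) * (1 - d / 2) ≤ 2 * d * (y - d/2) * (7/4 - d) :=
          mul_le_mul_of_nonneg_left (by linarith) (by positivity)
        nlinarith
      · rw [div_mul_eq_mul_div, le_div_iff₀ hpos]
        have h1 : 2 * min 1 (y ^ 2) - 2 * (y ^ 2 + d ^ 2 - √3 * (y * d)) ≤ 2 * d * (7/4 * y - d) := by
          nlinarith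
        have h2 : (7/4 * y - d) * (1 - d / 2) ≤ (7/4 - d) * (y - d/2) := by
          nlinarith [mul_nonneg hd (sub_nonneg.2 hy.2)]
        nlinarith
    have v1 : ∫ y in (d/2)..1, (2 * d * (7/4 - d) / (1 - d / 2)) * (y - d/2)
        = d * (7/4 - d) * (1 - d / 2) := by
      rw [intervalIntegral.integral_const_mul, intervalIntegral.integral_sub (by simp) (by simp),
        integral_id]
      simp only [intervalIntegral.integral_const, smul_eq_mul]
      have hne := hpos.ne'
      rw [div_mul_eq_mul_div, div_eq_iff hne]
      ring
    have e2 : ∫ y in (1:ℝ)..(5/2), (gn d p y + gn d q y) ≤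
        ∫ y in (1:ℝ)..(5/2), (max (1 ^ 2 - (y - d) ^ 2) 0 + max (w ^ 2 - (y - 3/4*d) ^ 2) 0) := by
      apply intervalIntegral.integral_mono_on (by norm_num) (hi _ _)
        (Continuous.intervalIntegrable (by fun_prop) _ _)
      intro y hy
      have hm : min 1 (y ^ 2) ≤ 1 := min_le_left _ _
      have hy0 : 0 ≤ y := by linarith [hy.1]
      have := hyd y hy0
      have b1 := le_max_left (1 ^ 2 - (y - d) ^ 2) 0
      have b2 := le_max_left (w ^ 2 - (y - 3/4*d) ^ 2) 0
      have b3 := le_max_right (1 ^ 2 - (y - d) ^ 2) 0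
      have b4 := le_max_right (w ^ 2 - (y - 3/4*d) ^ 2) 0
      apply key y _ hy0 (add_nonneg b3 b4)
      · generalize max (1 ^ 2 - (y - d) ^ 2) 0 = M at *
        generalize max (w ^ 2 - (y - 3/4*d) ^ 2) 0 = N at *
        linarith
      · generalize max (1 ^ 2 - (y - d) ^ 2) 0 = M at *
        generalize max (w ^ 2 - (y - 3/4*d) ^ 2) 0 = N at *
        linarith
    replace e2 := e2.trans_eq (intervalIntegral.integral_add
      (Continuous.intervalIntegrable (by fun_prop) _ _)
      (Continuous.intervalIntegrable (by fun_prop) _ _))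
    have e3 : ∫ y in (1:ℝ)..(5/2), max (1 ^ 2 - (y - d) ^ 2) 0 ≤ d - (1 + (d-1)^3)/3 := by
      refine (int_extend _ (by fun_prop) (fun y => le_max_right _ _) 1 (5/2) 1 (d+1) (by norm_num)
        (by linarith) (fun y h1 h2 => ?_) (fun y hy => ?_)).trans ?_
      · exact absurd h2 (by linarith)
      · exact max_le (by nlinarith) le_rfl
      · have : ∫ y in (1:ℝ)..(d+1), max (1 ^ 2 - (y - d) ^ 2) 0 ≤ ∫ y in (1:ℝ)..(d+1), (1 ^ 2 - (y - d) ^ 2) :=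
          intervalIntegral.integral_mono_on (by linarith)
            (Continuous.intervalIntegrable (by fun_prop) _ _) (Continuous.intervalIntegrable (by fun_prop) _ _)
            (fun y hy => by rw [max_eq_left]; nlinarith [hy.1, hy.2])
        rw [int_quad] at this
        linarith [this]
    have hw3 : w ^ 3 ≤ w ^ 2 * (w ^ 2 + 9/16) / (3/2) := by
      have : w ≤ (w ^ 2 + 9/16) / (3/2) := by nlinarith [sq_nonneg (w - 3/4)]
      calc w ^ 3 = w ^ 2 * w := by ring
        _ ≤ w ^ 2 * ((w ^ 2 + 9/16) / (3/2)) := mul_le_mul_of_nonneg_left this (sq_nonneg w)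
        _ = _ := by ring
    rw [hw2] at hw3
    rw [v1] at e1
    have fin : ∀ I1 I2 J1 J2 : ℝ, I1 ≤ d * (7/4 - d) * (1 - d / 2) → I2 ≤ J1 + J2 →
        J1 ≤ d - (1 + (d-1)^3)/3 → ((J2 ≤ 2/3 * w ^ 3) ∨ (4/3 ≤ d ∧ J2 ≤ 4/3 * w ^ 3)) → I1 + I2 ≤ 4/3 := by
      intro I1 I2 J1 J2 a1 a2 a3 a4
      have : ∃ X, d = 1 + X ∧ 0 ≤ X ∧ X ≤ 1/2 := ⟨d - 1, by ring, by linarith, by linarith⟩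
      obtain ⟨X, rfl, hX0, hX1⟩ := this
      rcases a4 with a4 | ⟨a4, a5⟩
      · nlinarith [pow_nonneg hX0 3, pow_nonneg hX0 4, pow_nonneg hX0 2, mul_nonneg hX0 (sub_nonneg.2 hX1), mul_nonneg (pow_nonneg hX0 2) (sub_nonneg.2 hX1), mul_nonneg (pow_nonneg hX0 3) (sub_nonneg.2 hX1)]
      · have : ∃ Y, X = 1/3 + Y ∧ 0 ≤ Y ∧ Y ≤ 1/6 := ⟨X - 1/3, by ring, by linarith, by linarith⟩
        obtain ⟨Y, rfl, hY0, hY1⟩ := this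
        nlinarith [pow_nonneg hY0 3, pow_nonneg hY0 4, pow_nonneg hY0 2, mul_nonneg hY0 (sub_nonneg.2 hY1), mul_nonneg (pow_nonneg hY0 2) (sub_nonneg.2 hY1), mul_nonneg (pow_nonneg hY0 3) (sub_nonneg.2 hY1)]
    refine fin _ _ _ _ e1 e2 e3 ?_
    rcases le_total d (4/3) with h43 | h43
    · exact Or.inl (int_quad_pos_half w (3/4*d) 1 (5/2) hw (by norm_num) (by linarith))
    · exact Or.inr ⟨h43, int_quad_pos w (3/4*d) 1 (5/2) hw (by norm_num)⟩

theorem sin_ge_of_mem (δ x : ℝ) (h0 : 0 < δ) (h1 : δ ≤ x) (h2 : x ≤ Real.pi - δ) :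
    Real.sin δ ≤ Real.sin x := by
  have h : Real.sin x - Real.sin δ = 2 * Real.sin ((x - δ) / 2) * Real.cos ((x + δ) / 2) :=
    Real.sin_sub_sin x δ
  have a : 0 ≤ Real.sin ((x - δ) / 2) := Real.sin_nonneg_of_nonneg_of_le_pi (by linarith) (by linarith)
  have b : 0 ≤ Real.cos ((x + δ) / 2) := Real.cos_nonneg_of_mem_Icc ⟨by linarith, by linarith⟩
  nlinarith [mul_nonneg a b]

theorem cos_le_of_int (m : ℕ) (hm : 3 ≤ m) (z : ℤ) (hz : z ≠ 0) (h1 : z ≤ m - 1) (h2 : -(m - 1 : ℤ) ≤ z) :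
    Real.cos (2 * Real.pi * z / m) ≤ Real.cos (2 * Real.pi / m) := by
  have hm0 : (0 : ℝ) < m := by positivity
  wlog hpos : 0 < z generalizing z with H
  · have := H (-z) (by omega) (by omega) (by omega) (by omega)
    rw [← Real.cos_neg] 
    convert this using 2
    push_cast; ring
  have z1 : (1 : ℝ) ≤ z := by exact_mod_cast hpos
  have z2 : (z : ℝ) ≤ m - 1 := by exact_mod_cast h1
  have h := Real.cos_sub_cos (2 * Real.pi / m) (2 * Real.pi * z / m)
  have a : 0 ≤ Real.sin ((2 * Real.pi / m + 2 * Real.pi * z / m) / 2) := by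
    apply Real.sin_nonneg_of_nonneg_of_le_pi
    · positivity
    · rw [← add_div, div_div, div_le_iff₀ (by positivity)]
      nlinarith [Real.pi_pos]
  have b : 0 ≤ Real.sin (-((2 * Real.pi / m - 2 * Real.pi * z / m) / 2)) := by
    apply Real.sin_nonneg_of_nonneg_of_le_pi
    · rw [← sub_div, div_div, ← neg_div]
      apply div_nonneg _ (by positivity)
      nlinarith [Real.pi_pos]
    · rw [← sub_div, div_div, ← neg_div, div_le_iff₀ (by positivity)]
      nlinarith [Real.pi_pos]
  rw [Real.sin_neg] at b
  nlinarith [mul_nonneg a b]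

theorem vtx_periodic (m : ℕ) (hm : 3 ≤ m) (r : ℝ) (j : ℕ) : vtx m r (j + m) = vtx m r j := by
  have hm0 : (m : ℝ) ≠ 0 := by positivity
  have : 2 * Real.pi * (((j + m : ℕ) : ℝ) - 1) / m = 2 * Real.pi * ((j : ℝ) - 1) / m + 2 * Real.pi := by
    push_cast; field_simp; ring
  unfold vtx
  rw [this, Real.cos_add_two_pi, Real.sin_add_two_pi]

/-- dot product -/
noncomputable def dt (p q : ℝ × ℝ) : ℝ := p.1 * q.1 + p.2 * q.2

theorem vtx_dot (m : ℕ) (r : ℝ) (i j : ℕ) :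
    dt (vtx m r i) (vtx m r j) = r ^ 2 * Real.cos (2 * Real.pi * ((i : ℤ) - (j : ℤ) : ℤ) / m) := by
  have : 2 * Real.pi * ((i : ℤ) - (j : ℤ) : ℤ) / m =
    2 * Real.pi * ((i : ℝ) - 1) / m - 2 * Real.pi * ((j : ℝ) - 1) / m := by push_cast; ring
  rw [this, Real.cos_sub]
  unfold dt vtx
  ring

theorem vtx_dot_le (m : ℕ) (hm : 3 ≤ m) (r : ℝ) (i j : ℕ) (hij : i ≠ j) (h1 : i ≤ j + (m - 1))
    (h2 : j ≤ i + (m - 1)) :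
    dt (vtx m r i) (vtx m r j) ≤ r ^ 2 * Real.cos (2 * Real.pi / m) := by
  rw [vtx_dot]
  apply mul_le_mul_of_nonneg_left _ (sq_nonneg r)
  apply cos_le_of_int m hm <;> omega

theorem vtx_dot_self (m : ℕ) (r : ℝ) (i : ℕ) : dt (vtx m r i) (vtx m r i) = r ^ 2 := by
  rw [vtx_dot]; simp

theorem vtx_dot_succ (m : ℕ) (r : ℝ) (i : ℕ) :
    dt (vtx m r i) (vtx m r (i+1)) = r ^ 2 * Real.cos (2 * Real.pi / m) := by
  rw [vtx_dot, ← Real.cos_neg]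
  congr 2
  push_cast; ring

theorem two_delta (m : ℕ) : Real.cos (2 * Real.pi / m) = 1 - 2 * Real.sin (Real.pi / m) ^ 2 := by
  have : 2 * Real.pi / m = 2 * (Real.pi / m) := by ring
  rw [this, Real.cos_two_mul, Real.cos_sq']; ring

theorem sin_delta_pos (m : ℕ) (hm : 3 ≤ m) : 0 < Real.sin (Real.pi / m) := by
  have hm0 : (3 : ℝ) ≤ m := by exact_mod_cast hm
  apply Real.sin_pos_of_pos_of_lt_pi (by positivity)
  rw [div_lt_iff₀ (by positivity)]
  nlinarith [Real.pi_pos]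

theorem sin_delta_le (m : ℕ) (hm : 3 ≤ m) : Real.sin (Real.pi / m) ≤ √3 / 2 := by
  have hm0 : (3 : ℝ) ≤ m := by exact_mod_cast hm
  rw [← Real.sin_pi_div_three]
  have := Real.pi_pos
  apply Real.sin_le_sin_of_le_of_le_pi_div_two
  · have : 0 < Real.pi / m := by positivity
    linarith
  · linarith
  · gcongr

theorem vtx_inj (m : ℕ) (hm : 3 ≤ m) (r : ℝ) (hr : 0 < r) : Set.InjOn (vtx m r) (Set.Icc 1 m) := by
  intro i hi j hj h
  by_contra hij
  have h1 := vtx_dot_le m hm r i j hij (by have := hi.2; have := hj.1; omega) (by have := hj.2; have := hi.1; omega)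
  rw [h, vtx_dot_self, two_delta] at h1
  have := sin_delta_pos m hm
  have : 0 < r ^ 2 * Real.sin (Real.pi / m) ^ 2 := by positivity
  nlinarith

/-- side parametrization -/
noncomputable def gam (m : ℕ) (r : ℝ) (j : ℕ) (t : ℝ) : ℝ × ℝ :=
  (1 - t) • vtx m r j + t • vtx m r (j + 1)

theorem gam_cont (m : ℕ) (r : ℝ) (j : ℕ) : Continuous (gam m r j) := by unfold gam; fun_prop

theorem sqDist_eq (p q : ℝ × ℝ) : sqDist p q = dt p p + dt q q - 2 * dt p q := by
  unfold sqDist dt; ring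

theorem dt_gam (m : ℕ) (r : ℝ) (j : ℕ) (t : ℝ) (q : ℝ × ℝ) :
    dt (gam m r j t) q = (1 - t) * dt (vtx m r j) q + t * dt (vtx m r (j+1)) q := by
  unfold dt gam; simp; ring

theorem dt_comm (p q : ℝ × ℝ) : dt p q = dt q p := by unfold dt; ring

/-- side length squared -/
noncomputable def Lsq (m : ℕ) (r : ℝ) : ℝ := (2 * r * Real.sin (Real.pi / m)) ^ 2

theorem sqDist_gam_left (m : ℕ) (r : ℝ) (j : ℕ) (t : ℝ) :
    sqDist (gam m r j t) (vtx m r j) = t ^ 2 * Lsq m r := by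
  rw [sqDist_eq, dt_gam, dt_gam, dt_comm _ (gam m r j t), dt_gam, dt_comm _ (gam m r j t), dt_gam,
    dt_comm (vtx m r (j+1)) (vtx m r j), vtx_dot_self, vtx_dot_self, vtx_dot_succ, two_delta, Lsq]
  ring

theorem sqDist_gam_right (m : ℕ) (r : ℝ) (j : ℕ) (t : ℝ) :
    sqDist (gam m r j t) (vtx m r (j+1)) = (1 - t) ^ 2 * Lsq m r := by
  rw [sqDist_eq, dt_gam, dt_gam, dt_comm _ (gam m r j t), dt_gam, dt_comm _ (gam m r j t), dt_gam,
    dt_comm (vtx m r (j+1)) (vtx m r j), vtx_dot_self, vtx_dot_self, vtx_dot_succ, two_delta, Lsq]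
  ring

/-- any vertex is at least as far as the nearest endpoint -/
theorem sqDist_gam_vtx (m : ℕ) (hm : 3 ≤ m) (r : ℝ) (j l : ℕ) (hj : j ∈ Set.Icc 1 m)
    (hl : l ∈ Set.Icc 1 m) (t : ℝ) (ht : t ∈ Set.Icc (0:ℝ) 1) :
    min (t ^ 2 * Lsq m r) ((1 - t) ^ 2 * Lsq m r) ≤ sqDist (gam m r j t) (vtx m r l) := by
  obtain ⟨j1, j2⟩ := hj
  obtain ⟨l1, l2⟩ := hl
  obtain ⟨t1, t2⟩ := ht
  by_cases h1 : l = j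
  · subst h1; rw [sqDist_gam_left]; exact min_le_left _ _
  by_cases h2 : l = j + 1
  · subst h2; rw [sqDist_gam_right]; exact min_le_right _ _
  by_cases h3 : l + m = j + 1
  · rw [← vtx_periodic m hm r l, h3, sqDist_gam_right]; exact min_le_right _ _
  have a1 := vtx_dot_le m hm r j l (by omega) (by omega) (by omega)
  have a2 := vtx_dot_le m hm r (j+1) l (by omega) (by omega) (by omega)
  refine (min_le_left _ _).trans ?_
  rw [← sqDist_gam_left m r j t, sqDist_eq, sqDist_eq, dt_gam _ _ _ _ (vtx m r l), vtx_dot_self, vtx_dot_self,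
    dt_gam _ _ _ _ (vtx m r j), vtx_dot_self, dt_comm (vtx m r (j+1)) (vtx m r j), vtx_dot_succ]
  have hc : Real.cos (2 * Real.pi / m) ≤ 1 := Real.cos_le_one _
  have b1 := mul_le_mul_of_nonneg_left a1 (sub_nonneg.2 t2)
  have b2 := mul_le_mul_of_nonneg_left a2 t1
  have b3 : 0 ≤ (1 - t) * (r ^ 2 * (1 - Real.cos (2 * Real.pi / m))) := 
    mul_nonneg (sub_nonneg.2 t2) (mul_nonneg (sq_nonneg r) (by linarith))
  nlinarith

theorem sin_mix (m : ℕ) (hm : 3 ≤ m) (z t : ℝ) (hz : 1 ≤ z) (t1 : 0 ≤ t) (t2 : t ≤ 1)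
    (h : 2 * z + 2 ≤ m ∨ (2 * z + 1 ≤ m ∧ t ≤ 1/2)) :
    Real.sin (Real.pi / m) / 2 ≤ (1 - t) * Real.sin (2 * (Real.pi / m) * z - Real.pi / m)
      + t * Real.sin (2 * (Real.pi / m) * z + Real.pi / m) := by
  have hs := sin_delta_pos m hm
  have hm0 : (0 : ℝ) < m := by positivity
  have hp : (m : ℝ) * (Real.pi / m) = Real.pi := by field_simp
  have hδ : 0 < Real.pi / m := by positivity
  set δ := Real.pi / m
  have hz2 : 2 * z + 1 ≤ m := by rcases h with h | h <;> linarith [h]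
  have a1 : Real.sin δ ≤ Real.sin (2 * δ * z - δ) := by
    apply sin_ge_of_mem δ _ hδ <;> nlinarith
  rcases h with h | ⟨h, ht⟩
  · have a2 : Real.sin δ ≤ Real.sin (2 * δ * z + δ) := by
      apply sin_ge_of_mem δ _ hδ <;> nlinarith
    nlinarith
  · have a2 : 0 ≤ Real.sin (2 * δ * z + δ) := by
      apply Real.sin_nonneg_of_nonneg_of_le_pi <;> nlinarith
    nlinarith

/-- far sides -/
theorem far_side (m : ℕ) (hm : 3 ≤ m) (r : ℝ) (hr : 0 < r) (i z : ℕ) (hi : 1 ≤ i)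
    (hz1 : 1 ≤ z) (hz2 : z + 2 ≤ m) (a : ℝ × ℝ)
    (h1 : dt a (vtx m r (i + 1)) ≤ dt a (vtx m r i))
    (h2 : dt a (vtx m r (i + (m - 1))) ≤ dt a (vtx m r i)) (t : ℝ) (ht : t ∈ Set.Icc (0:ℝ) 1) :
    Lsq m r / 16 ≤ sqDist (gam m r (i + z) t) a := by
  obtain ⟨t1, t2⟩ := ht
  have hs := sin_delta_pos m hm
  have hm0 : (m : ℝ) ≠ 0 := by positivity
  have hp : (m : ℝ) * (Real.pi / m) = Real.pi := by field_simp
  have hz1' : (1 : ℝ) ≤ z := by exact_mod_cast hz1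
  have hz2' : (z : ℝ) + 2 ≤ m := by exact_mod_cast hz2
  obtain ⟨θ, hθ⟩ : ∃ θ, θ = 2 * Real.pi * ((i : ℝ) - 1) / m := ⟨_, rfl⟩
  have e0 : vtx m r i = (r * Real.cos θ, r * Real.sin θ) := by rw [hθ]; rfl
  have ez : ∀ z : ℕ, vtx m r (i + z) = (r * Real.cos (θ + 2 * (Real.pi / m) * z), r * Real.sin (θ + 2 * (Real.pi / m) * z)) := by
    intro z
    unfold vtx
    have : 2 * Real.pi * (((i + z : ℕ) : ℝ) - 1) / m = θ + 2 * (Real.pi / m) * z := by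
      rw [hθ]; push_cast; ring
    rw [this]
  have e1 : vtx m r (i + 1) = (r * Real.cos (θ + 2 * (Real.pi / m)), r * Real.sin (θ + 2 * (Real.pi / m))) := by
    rw [ez]; simp
  have em : vtx m r (i + (m - 1)) = (r * Real.cos (θ - 2 * (Real.pi / m)), r * Real.sin (θ - 2 * (Real.pi / m))) := by
    rw [ez]
    have : θ + 2 * (Real.pi / m) * ((m - 1 : ℕ) : ℝ) = θ - 2 * (Real.pi / m) + 2 * Real.pi := by
      rw [Nat.cast_sub (by omega)]; push_cast; linarith
    rw [this, Real.cos_add_two_pi, Real.sin_add_two_pi]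
  have eg : gam m r (i + z) t = (1 - t) • (r * Real.cos (θ + 2 * (Real.pi / m) * z), r * Real.sin (θ + 2 * (Real.pi / m) * z)) + t • (r * Real.cos (θ + 2 * (Real.pi / m) * (z + 1 : ℕ)), r * Real.sin (θ + 2 * (Real.pi / m) * (z + 1 : ℕ))) := by
    unfold gam; rw [ez, add_assoc, ez]
  -- it suffices to exhibit a unit direction
  have suff : ∀ ω : ℝ, r * (Real.sin (Real.pi / m) / 2) ≤
      dt (gam m r (i + z) t) (-Real.sin ω, Real.cos ω) → dt a (-Real.sin ω, Real.cos ω) ≤ 0 →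
      Lsq m r / 16 ≤ sqDist (gam m r (i + z) t) a := by
    intro ω b1 b2
    generalize gam m r (i + z) t = x at *
    have hω := Real.sin_sq_add_cos_sq ω
    have hcs : ((x.1 - a.1) * (-Real.sin ω) + (x.2 - a.2) * Real.cos ω) ^ 2 ≤ sqDist x a := by
      unfold sqDist
      nlinarith [sq_nonneg ((x.1 - a.1) * Real.cos ω + (x.2 - a.2) * Real.sin ω)]
    have hb : r * (Real.sin (Real.pi / m) / 2) ≤ (x.1 - a.1) * (-Real.sin ω) + (x.2 - a.2) * Real.cos ω := by
      unfold dt at b1 b2; simp only at b1 b2; linarith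
    have hr0 : 0 ≤ r * (Real.sin (Real.pi / m) / 2) := by positivity
    refine le_trans ?_ hcs
    refine le_trans (le_of_eq ?_) (pow_le_pow_left₀ hr0 hb 2)
    unfold Lsq; ring
  have hpt : ∀ φ ω : ℝ, (r * Real.cos φ) * (-Real.sin ω) + (r * Real.sin φ) * Real.cos ω = r * Real.sin (φ - ω) := by
    intro φ ω; rw [Real.sin_sub]; ring
  set δ := Real.pi / m with hδ
  by_cases hc : (2 * (z:ℝ) + 2 ≤ m ∨ (2 * (z:ℝ) + 1 ≤ m ∧ t ≤ 1/2))
  · apply suff (θ + δ)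
    · have := sin_mix m hm z t hz1' t1 t2 hc
      rw [← hδ] at this
      have h3 : dt (gam m r (i + z) t) (-Real.sin (θ + δ), Real.cos (θ + δ)) =
        (1 - t) * (r * Real.sin (2 * δ * z - δ)) + t * (r * Real.sin (2 * δ * z + δ)) := by
        have q1 := hpt (θ + 2 * δ * z) (θ + δ)
        have q2 := hpt (θ + 2 * δ * (z + 1 : ℕ)) (θ + δ)
        rw [show θ + 2 * δ * z - (θ + δ) = 2 * δ * z - δ by ring] at q1
        rw [show θ + 2 * δ * (z + 1 : ℕ) - (θ + δ) = 2 * δ * z + δ by push_cast; ring] at q2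
        rw [← q1, ← q2, eg]
        unfold dt; simp; ring
      rw [h3]
      have := mul_le_mul_of_nonneg_left this hr.le
      linarith
    · rw [e0, e1] at h1
      have k1 : Real.cos (θ + 2 * δ) - Real.cos θ = - 2 * Real.sin (θ + δ) * Real.sin δ := by
        rw [Real.cos_sub_cos]; ring_nf
      have k2 : Real.sin (θ + 2 * δ) - Real.sin θ = 2 * Real.sin δ * Real.cos (θ + δ) := by
        rw [Real.sin_sub_sin]; ring_nf
      have k3 : (2 * r * Real.sin δ) * dt a (-Real.sin (θ + δ), Real.cos (θ + δ)) ≤ 0 := by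
        have k4 : (2 * r * Real.sin δ) * dt a (-Real.sin (θ + δ), Real.cos (θ + δ)) =
          r * (a.1 * (Real.cos (θ + 2 * δ) - Real.cos θ) + a.2 * (Real.sin (θ + 2 * δ) - Real.sin θ)) := by
          rw [k1, k2]; unfold dt; ring
        rw [k4]; unfold dt at h1; simp only at h1; linarith
      by_contra hcon
      push Not at hcon
      have : 0 < (2 * r * Real.sin δ) * dt a (-Real.sin (θ + δ), Real.cos (θ + δ)) := by positivity
      linarith
  · push Not at hc
    have hc1 : (m : ℝ) ≤ 2 * z + 1 := by
      have : m < 2 * z + 2 := by exact_mod_cast hc.1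
      exact_mod_cast (show m ≤ 2 * z + 1 by omega)
    have hcc : 2 * ((m : ℝ) - 1 - z) + 2 ≤ m ∨ (2 * ((m:ℝ) - 1 - z) + 1 ≤ m ∧ 1 - t ≤ 1/2) := by
      rcases hc1.lt_or_eq with h | h
      · left
        have : m < 2 * z + 1 := by exact_mod_cast h
        have : (m : ℝ) ≤ 2 * z := by exact_mod_cast (show m ≤ 2 * z by omega)
        linarith
      · right
        have := hc.2 h.ge
        constructor <;> linarith
    apply suff (θ - δ + Real.pi)
    · have := sin_mix m hm (m - 1 - z) (1 - t) (by linarith) (by linarith) (by linarith) hcc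
      rw [← hδ] at this
      have h3 : dt (gam m r (i + z) t) (-Real.sin (θ - δ + Real.pi), Real.cos (θ - δ + Real.pi)) =
        (1 - t) * (r * Real.sin (2 * δ * (m - 1 - z) + δ)) + t * (r * Real.sin (2 * δ * (m - 1 - z) - δ)) := by
        have q1 := hpt (θ + 2 * δ * z) (θ - δ + Real.pi)
        have q2 := hpt (θ + 2 * δ * (z + 1 : ℕ)) (θ - δ + Real.pi)
        rw [show θ + 2 * δ * z - (θ - δ + Real.pi) = Real.pi - (2 * δ * (m - 1 - z) + δ) by
          linear_combination 2 * hp, Real.sin_pi_sub] at q1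
        rw [show θ + 2 * δ * (z + 1 : ℕ) - (θ - δ + Real.pi) = Real.pi - (2 * δ * (m - 1 - z) - δ) by
          push_cast; linear_combination 2 * hp, Real.sin_pi_sub] at q2
        rw [← q1, ← q2, eg]
        unfold dt; simp; ring
      rw [h3]
      have := mul_le_mul_of_nonneg_left this hr.le
      linarith
    · rw [e0, em] at h2
      rw [Real.sin_add_pi, Real.cos_add_pi]
      have k1 : Real.cos (θ - 2 * δ) - Real.cos θ = 2 * Real.sin (θ - δ) * Real.sin δ := by
        rw [Real.cos_sub_cos, show (θ - 2 * δ - θ) / 2 = -δ by ring, Real.sin_neg]; ring_nf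
      have k2 : Real.sin (θ - 2 * δ) - Real.sin θ = - 2 * Real.sin δ * Real.cos (θ - δ) := by
        rw [Real.sin_sub_sin, show (θ - 2 * δ - θ) / 2 = -δ by ring, Real.sin_neg]; ring_nf
      have k3 : (2 * r * Real.sin δ) * dt a (- -Real.sin (θ - δ), -Real.cos (θ - δ)) ≤ 0 := by
        have k4 : (2 * r * Real.sin δ) * dt a (- -Real.sin (θ - δ), -Real.cos (θ - δ)) =
          r * (a.1 * (Real.cos (θ - 2 * δ) - Real.cos θ) + a.2 * (Real.sin (θ - 2 * δ) - Real.sin θ)) := by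
          rw [k1, k2]; unfold dt; ring
        rw [k4]; unfold dt at h2; simp only at h2; linarith
      by_contra hcon
      push Not at hcon
      have : 0 < (2 * r * Real.sin δ) * dt a (- -Real.sin (θ - δ), -Real.cos (θ - δ)) := by positivity
      linarith

/-- lower barrier on a side -/
noncomputable def bh (m : ℕ) (r : ℝ) (k : ℕ) (t : ℝ) : ℝ :=
  min (Lsq m r / (4 * (k:ℝ) ^ 2)) (min (t ^ 2 * Lsq m r) ((1 - t) ^ 2 * Lsq m r))

/-- gain of a point on a side -/
noncomputable def gain (m : ℕ) (r : ℝ) (k : ℕ) (a : ℝ × ℝ) (j : ℕ) (t : ℝ) : ℝ :=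
  max (bh m r k t - sqDist (gam m r j t) a) 0

theorem bh_cont (m : ℕ) (r : ℝ) (k : ℕ) : Continuous (bh m r k) := by unfold bh; fun_prop

theorem gain_cont (m : ℕ) (r : ℝ) (k : ℕ) (a : ℝ × ℝ) (j : ℕ) : Continuous (gain m r k a j) := by
  have := bh_cont m r k
  have := gam_cont m r j
  unfold gain sqDist; fun_prop

theorem bh_symm (m : ℕ) (r : ℝ) (k : ℕ) (t : ℝ) : bh m r k (1 - t) = bh m r k t := by
  unfold bh; rw [sub_sub_cancel, min_comm ((1 - t) ^ 2 * Lsq m r)]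

theorem gam_periodic (m : ℕ) (hm : 3 ≤ m) (r : ℝ) (j : ℕ) : gam m r (j + m) = gam m r j := by
  funext t
  unfold gam
  rw [vtx_periodic m hm, show j + m + 1 = (j + 1) + m by ring, vtx_periodic m hm]

theorem sum_periodic (F : ℕ → ℝ) (m : ℕ) (hF : ∀ j, F (j + m) = F j) (i : ℕ) :
    ∑ z ∈ Finset.range m, F (i + z) = ∑ z ∈ Finset.range m, F z := by
  induction i with
  | zero => simp
  | succ i ih =>
    rw [← ih]
    have h1 := Finset.sum_range_succ (fun z => F (i + z)) m
    have h2 := Finset.sum_range_succ' (fun z => F (i + z)) m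
    rw [h1, hF] at h2
    simp only [add_zero, add_left_inj] at h2
    rw [h2]
    apply Finset.sum_congr rfl
    intro z _
    congr 1; ring

theorem side_gain (m : ℕ) (r : ℝ) (k : ℕ) (ρ d P t S : ℝ) (hk : 0 < (k:ℝ)) (hρ : 0 < ρ)
    (hL : Lsq m r = (2 * k * ρ) ^ 2) (hS : S = t ^ 2 * Lsq m r - 2 * t * P + (ρ * d) ^ 2) :
    max (bh m r k t - S) 0 ≤ ρ ^ 2 * gn d (P / (2 * k * ρ ^ 2)) (2 * k * t) := by
  have e : ρ ^ 2 * gn d (P / (2 * k * ρ ^ 2)) (2 * k * t) =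
      max (min (ρ ^ 2) (t ^ 2 * Lsq m r) - S) 0 := by
    unfold gn
    rw [mul_max_of_nonneg _ _ (sq_nonneg ρ), mul_zero, mul_sub, mul_min_of_nonneg _ _ (sq_nonneg ρ), hS, hL]
    congr 2
    · congr 1
      · ring
      · ring
    · field_simp
  rw [e]
  apply max_le_max_right
  apply sub_le_sub_right
  unfold bh
  apply min_le_min
  · rw [hL]; apply le_of_eq; field_simp; ring
  · exact min_le_left _ _

theorem cs_two (a b c d : ℝ) : (a * c + b * d) ^ 2 ≤ (a ^ 2 + b ^ 2) * (c ^ 2 + d ^ 2) := by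
  nlinarith [sq_nonneg (a * d - b * c)]

set_option maxHeartbeats 1000000 in
theorem key_gain (m : ℕ) (hm : 3 ≤ m) (r : ℝ) (hr : 0 < r) (k : ℕ) (hk : 2 ≤ k) (a : ℝ × ℝ) :
    ∑ j ∈ Finset.Icc 1 m, ∫ t in (0:ℝ)..1, gain m r k a j t ≤ Lsq m r / (6 * (k:ℝ) ^ 3) := by
  obtain ⟨i, hi, hmax⟩ := Finset.exists_max_image (Finset.Icc 1 m) (fun i => dt a (vtx m r i))
    ⟨1, by simp; omega⟩
  rw [Finset.mem_Icc] at hi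
  obtain ⟨hi1, hi2⟩ := hi
  have h1 : dt a (vtx m r (i + 1)) ≤ dt a (vtx m r i) := by
    by_cases h : i + 1 ≤ m
    · exact hmax _ (by rw [Finset.mem_Icc]; omega)
    · have : i + 1 = 1 + m := by omega
      rw [this, vtx_periodic m hm]
      exact hmax _ (by rw [Finset.mem_Icc]; omega)
  have h2 : dt a (vtx m r (i + (m - 1))) ≤ dt a (vtx m r i) := by
    by_cases h : i = 1
    · exact hmax _ (by rw [Finset.mem_Icc]; omega)
    · have : i + (m - 1) = (i - 1) + m := by omega
      rw [this, vtx_periodic m hm]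
      exact hmax _ (by rw [Finset.mem_Icc]; omega)
  have hs := sin_delta_pos m hm
  have hs3 := sin_delta_le m hm
  have hk0 : (0:ℝ) < k := by positivity
  have hk2 : (2:ℝ) ≤ k := by exact_mod_cast hk
  obtain ⟨ρ, hρd⟩ : ∃ ρ, ρ = r * Real.sin (Real.pi / m) / k := ⟨_, rfl⟩
  have hρ : 0 < ρ := by rw [hρd]; positivity
  have hL : Lsq m r = (2 * k * ρ) ^ 2 := by rw [hρd]; unfold Lsq; field_simp
  have hLpos : 0 < Lsq m r := by rw [hL]; positivity
  -- reindex
  have hF : ∀ j, (∫ t in (0:ℝ)..1, gain m r k a (j + m) t) = ∫ t in (0:ℝ)..1, gain m r k a j t := by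
    intro j; unfold gain; rw [gam_periodic m hm]
  have hsum : ∑ j ∈ Finset.Icc 1 m, ∫ t in (0:ℝ)..1, gain m r k a j t =
      ∑ z ∈ Finset.range m, ∫ t in (0:ℝ)..1, gain m r k a (i + z) t := by
    have hp := fun i => sum_periodic (fun j => ∫ t in (0:ℝ)..1, gain m r k a j t) m hF i
    rw [hp i, ← hp 1]
    have : Finset.Icc 1 m = Finset.Ico 1 (m + 1) := by ext x; rw [Finset.mem_Icc, Finset.mem_Ico]; omega
    rw [this, Finset.sum_Ico_eq_sum_range, Nat.add_sub_cancel]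
  rw [hsum]
  obtain ⟨M, rfl⟩ : ∃ M, m = M + 2 := ⟨m - 2, by omega⟩
  rw [Finset.sum_range_succ, Finset.sum_range_succ']
  have hmid : ∑ z ∈ Finset.range M, ∫ t in (0:ℝ)..1, gain (M+2) r k a (i + (z + 1)) t ≤ 0 := by
    apply Finset.sum_nonpos
    intro z hz
    rw [Finset.mem_range] at hz
    have : ∫ t in (0:ℝ)..1, gain (M+2) r k a (i + (z + 1)) t ≤ ∫ t in (0:ℝ)..1, (0:ℝ) := by
      apply intervalIntegral.integral_mono_on zero_le_one
        ((gain_cont _ _ _ _ _).intervalIntegrable _ _) (by simp)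
      intro t ht
      have := far_side (M+2) hm r hr i (z+1) hi1 (by omega) (by omega) a h1 h2 t ht
      apply max_le _ le_rfl
      have hb : bh (M+2) r k t ≤ Lsq (M+2) r / 16 := by
        refine (min_le_left _ _).trans ?_
        gcongr
        nlinarith
      linarith
    simpa using this
  simp only [add_zero]
  -- geometry at the vertex
  have e1 : M + 2 - 1 = M + 1 := by omega
  rw [e1] at h2
  have hV1 : vtx (M+2) r (i + (M + 1) + 1) = vtx (M+2) r i := by
    rw [show i + (M + 1) + 1 = i + (M + 2) by ring, vtx_periodic _ hm]
  have hWU : vtx (M+2) r (i+1) + vtx (M+2) r (i + (M+1)) =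
      (2 * Real.cos (2 * Real.pi / (M+2 : ℕ))) • vtx (M+2) r i := by
    have hm0 : ((M + 2 : ℕ) : ℝ) ≠ 0 := by positivity
    unfold vtx
    have a1 : 2 * Real.pi * (((i + 1 : ℕ) : ℝ) - 1) / (M+2 : ℕ) =
      2 * Real.pi * ((i:ℝ) - 1) / (M+2 : ℕ) + 2 * Real.pi / (M+2 : ℕ) := by push_cast; ring
    have a2 : 2 * Real.pi * (((i + (M+1) : ℕ) : ℝ) - 1) / (M+2 : ℕ) =
      2 * Real.pi * ((i:ℝ) - 1) / (M+2 : ℕ) - 2 * Real.pi / (M+2 : ℕ) + 2 * Real.pi := by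
      push_cast at hm0 ⊢; field_simp; ring
    rw [a1, a2, Real.cos_add_two_pi, Real.sin_add_two_pi, Real.cos_add, Real.cos_sub, Real.sin_add, Real.sin_sub]
    ext <;> simp <;> ring
  have hWV : sqDist (vtx (M+2) r (i+1)) (vtx (M+2) r i) = Lsq (M+2) r := by
    have := sqDist_gam_left (M+2) r i 1
    simpa [gam] using this
  have hUV : sqDist (vtx (M+2) r (i+(M+1))) (vtx (M+2) r i) = Lsq (M+2) r := by
    have := sqDist_gam_right (M+2) r (i+(M+1)) 0
    rw [hV1] at this
    simpa [gam] using this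
  have hVV : dt (vtx (M+2) r i) (vtx (M+2) r i) = r ^ 2 := vtx_dot_self _ _ _
  have g1 : ∀ t, gam (M+2) r i t = (1 - t) • vtx (M+2) r i + t • vtx (M+2) r (i+1) := fun t => rfl
  have g2 : ∀ t, gam (M+2) r (i+(M+1)) (1 - t) = t • vtx (M+2) r (i+(M+1)) + (1 - t) • vtx (M+2) r i := by
    intro t; unfold gam; rw [hV1, sub_sub_cancel]
  rw [two_delta] at hWU
  generalize vtx (M+2) r i = V at *
  generalize vtx (M+2) r (i+1) = W at *
  generalize vtx (M+2) r (i+(M+1)) = U at *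
  obtain ⟨d, hd0, hd⟩ : ∃ d, 0 ≤ d ∧ (ρ * d) ^ 2 = sqDist a V := by
    refine ⟨√(sqDist a V) / ρ, by positivity, ?_⟩
    rw [mul_div_cancel₀ _ hρ.ne', Real.sq_sqrt]
    unfold sqDist; positivity
  obtain ⟨P, hP⟩ : ∃ P, P = (W.1 - V.1) * (a.1 - V.1) + (W.2 - V.2) * (a.2 - V.2) := ⟨_, rfl⟩
  obtain ⟨Q, hQ⟩ : ∃ Q, Q = (U.1 - V.1) * (a.1 - V.1) + (U.2 - V.2) * (a.2 - V.2) := ⟨_, rfl⟩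
  have hPd : P ≤ 2 * k * ρ * (ρ * d) := by
    refine (abs_le_of_sq_le_sq' ?_ (by positivity)).2
    rw [mul_pow, hd, ← hL, ← hWV, hP]
    exact cs_two _ _ _ _
  have hQd : Q ≤ 2 * k * ρ * (ρ * d) := by
    refine (abs_le_of_sq_le_sq' ?_ (by positivity)).2
    rw [mul_pow, hd, ← hL, ← hUV, hQ]
    exact cs_two _ _ _ _
  have hPQd : P + Q ≤ √3 * (2 * k * ρ * (ρ * d)) := by
    refine (abs_le_of_sq_le_sq' ?_ (by positivity)).2
    rw [mul_pow, mul_pow _ (ρ * d), hd, ← hL, Real.sq_sqrt (by norm_num)]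
    generalize Real.sin (Real.pi / (M+2 : ℕ)) = s at *
    have w1 : W.1 + U.1 = 2 * (1 - 2 * s ^ 2) * V.1 := by
      have := congrArg Prod.fst hWU; simpa using this
    have w2 : W.2 + U.2 = 2 * (1 - 2 * s ^ 2) * V.2 := by
      have := congrArg Prod.snd hWU; simpa using this
    have hPQ : P + Q = -4 * s ^ 2 * (V.1 * (a.1 - V.1) + V.2 * (a.2 - V.2)) := by
      rw [hP, hQ]; linear_combination (a.1 - V.1) * w1 + (a.2 - V.2) * w2
    have cs : (V.1 * (a.1 - V.1) + V.2 * (a.2 - V.2)) ^ 2 ≤ r ^ 2 * sqDist a V := by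
      have := cs_two V.1 V.2 (a.1 - V.1) (a.2 - V.2)
      rw [← hVV]; unfold sqDist dt
      simpa only [sq] using this
    have s2 : 4 * s ^ 2 ≤ 3 := by
      have := pow_le_pow_left₀ hs.le hs3 2
      rw [div_pow, Real.sq_sqrt (by norm_num)] at this
      linarith
    have hLs : Lsq (M+2) r = 4 * s ^ 2 * r ^ 2 := by rw [hL, hρd]; field_simp; ring
    have hC : 0 ≤ sqDist a V := by unfold sqDist; positivity
    rw [hPQ, hLs]
    calc (-4 * s ^ 2 * (V.1 * (a.1 - V.1) + V.2 * (a.2 - V.2))) ^ 2 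
        = 16 * s ^ 4 * (V.1 * (a.1 - V.1) + V.2 * (a.2 - V.2)) ^ 2 := by ring
      _ ≤ 16 * s ^ 4 * (r ^ 2 * sqDist a V) := by gcongr
      _ = (4 * s ^ 2) * (4 * s ^ 2 * r ^ 2 * sqDist a V) := by ring
      _ ≤ 3 * (4 * s ^ 2 * r ^ 2 * sqDist a V) := by gcongr
      _ = _ := by ring
  have hden : 0 < 2 * k * ρ ^ 2 := by positivity
  have c := core d (P / (2 * k * ρ ^ 2)) (Q / (2 * k * ρ ^ 2)) (2 * k) hd0 (by positivity)
    (by rw [div_le_iff₀ hden]; linarith) (by rw [div_le_iff₀ hden]; linarith)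
    (by rw [← add_div, div_le_iff₀ hden]; linarith)
  have cg := fun p => gn_cont d p
  have i1 : ∫ t in (0:ℝ)..1, gain (M+2) r k a i t ≤
      ∫ t in (0:ℝ)..1, ρ ^ 2 * gn d (P / (2 * k * ρ ^ 2)) (2 * k * t) := by
    apply intervalIntegral.integral_mono_on zero_le_one
        ((gain_cont _ _ _ _ _).intervalIntegrable _ _)
        (Continuous.intervalIntegrable (by have := cg (P / (2 * k * ρ ^ 2)); fun_prop) _ _)
    intro t _
    apply side_gain (M+2) r k ρ d P t _ hk0 hρ hL
    rw [g1, hd, hP, ← hWV]; unfold sqDist; simp; ring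
  have i2 : ∫ t in (0:ℝ)..1, gain (M+2) r k a (i+(M+1)) t ≤
      ∫ t in (0:ℝ)..1, ρ ^ 2 * gn d (Q / (2 * k * ρ ^ 2)) (2 * k * t) := by
    have := intervalIntegral.integral_comp_sub_left (a := 0) (b := 1) (gain (M+2) r k a (i+(M+1))) 1
    simp only [sub_self, sub_zero] at this
    rw [← this]
    apply intervalIntegral.integral_mono_on zero_le_one
        (Continuous.intervalIntegrable (by have := gain_cont (M+2) r k a (i+(M+1)); fun_prop) _ _)
        (Continuous.intervalIntegrable (by have := cg (Q / (2 * k * ρ ^ 2)); fun_prop) _ _)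
    intro t _
    unfold gain
    rw [bh_symm]
    apply side_gain (M+2) r k ρ d Q t _ hk0 hρ hL
    rw [g2, hd, hQ, ← hUV]; unfold sqDist; simp; ring
  rw [intervalIntegral.integral_const_mul,
    intervalIntegral.integral_comp_mul_left (fun y => gn d _ y) (by positivity : (2 * (k:ℝ)) ≠ 0)] at i1 i2
  rw [intervalIntegral.integral_add ((cg _).intervalIntegrable _ _) ((cg _).intervalIntegrable _ _)] at c
  simp only [mul_zero, mul_one, smul_eq_mul] at i1 i2
  have hfin : Lsq (M+2) r / (6 * (k:ℝ) ^ 3) = ρ ^ 2 * ((2 * (k:ℝ))⁻¹ * (4/3)) := by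
    rw [hL]; field_simp; ring
  rw [hfin]
  have c2 := mul_le_mul_of_nonneg_left c (by positivity : 0 ≤ ρ ^ 2 * (2 * (k:ℝ))⁻¹)
  linarith

theorem finf_le {s : Set (ℝ × ℝ)} (hs : s.Finite) {a : ℝ × ℝ} (ha : a ∈ s) (x : ℝ × ℝ) :
    sInf (sqDist x '' s) ≤ sqDist x a :=
  csInf_le (hs.image _).bddBelow ⟨a, ha, rfl⟩

theorem finf_mem {s : Set (ℝ × ℝ)} (hs : s.Finite) (hne : s.Nonempty) (x : ℝ × ℝ) :
    ∃ a ∈ s, sqDist x a = sInf (sqDist x '' s) :=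
  (hne.image (sqDist x)).csInf_mem (hs.image _)

theorem sqDist_cont (a : ℝ × ℝ) : Continuous (fun x => sqDist x a) := by
  unfold sqDist; fun_prop

theorem finf_cont {s : Set (ℝ × ℝ)} (hs : s.Finite) (hne : s.Nonempty) :
    Continuous (fun x => sInf (sqDist x '' s)) := by
  have hne' : hs.toFinset.Nonempty := by simpa using hne
  have h := Continuous.finset_inf'_apply (f := fun a x => sqDist x a) hne'
    (fun a _ => sqDist_cont a)
  convert h using 2 with x
  rw [Finset.inf'_eq_csInf_image]
  simp

theorem poly_integral (m : ℕ) (hm : 3 ≤ m) (r : ℝ) (f : ℝ × ℝ → ℝ) (hf : Continuous f) :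
    ∫ x, f x ∂(polyUniform m r) =
      (1 / (m:ℝ)) * ∑ j ∈ Finset.Icc 1 m, ∫ t in (0:ℝ)..1, f (gam m r j t) := by
  have hu : uniformOn 0 1 = volume.restrict (Set.Icc (0:ℝ) 1) := by
    unfold uniformOn; simp
  unfold polyUniform
  rw [integral_smul_measure, integral_finsetSum_measure]
  · rw [smul_eq_mul, ENNReal.toReal_inv, ENNReal.toReal_natCast, one_div]
    congr 1
    apply Finset.sum_congr rfl
    intro j _
    have hg : Continuous (fun t : ℝ => (1 - t) • vtx m r j + t • vtx m r (j + 1)) := gam_cont m r j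
    rw [integral_map hg.aemeasurable hf.aestronglyMeasurable, hu,
      intervalIntegral.integral_of_le zero_le_one, integral_Icc_eq_integral_Ioc]
    rfl
  · intro j _
    have hg : Continuous (fun t : ℝ => (1 - t) • vtx m r j + t • vtx m r (j + 1)) := gam_cont m r j
    rw [integrable_map_measure hf.aestronglyMeasurable hg.aemeasurable, hu]
    exact (hf.comp hg).continuousOn.integrableOn_Icc

theorem bh_integral (m : ℕ) (r : ℝ) (k : ℕ) (hk : 1 ≤ k) :
    Lsq m r / (4 * (k:ℝ) ^ 2) * (1 - 2 / (3 * k)) ≤ ∫ t in (0:ℝ)..1, bh m r k t := by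
  have hk1 : (1:ℝ) ≤ k := by exact_mod_cast hk
  have hk0 : (0:ℝ) < k := by linarith
  have hL0 : 0 ≤ Lsq m r := by unfold Lsq; positivity
  obtain ⟨c, hc⟩ : ∃ c : ℝ, c = 1 / (2 * k) := ⟨_, rfl⟩
  have hc0 : 0 < c := by rw [hc]; positivity
  have hc1 : c ≤ 1 / 2 := by rw [hc]; gcongr; linarith
  have hcc : Lsq m r / (4 * (k:ℝ) ^ 2) = c ^ 2 * Lsq m r := by rw [hc]; field_simp; norm_num
  have hi : ∀ a b, IntervalIntegrable (bh m r k) volume a b := fun a b => (bh_cont m r k).intervalIntegrable a b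
  rw [← intervalIntegral.integral_add_adjacent_intervals (hi 0 c) (hi c 1),
    ← intervalIntegral.integral_add_adjacent_intervals (hi c (1 - c)) (hi (1 - c) 1)]
  have e1 : ∫ t in (0:ℝ)..c, t ^ 2 * Lsq m r ≤ ∫ t in (0:ℝ)..c, bh m r k t := by
    apply intervalIntegral.integral_mono_on hc0.le
      (Continuous.intervalIntegrable (by fun_prop) _ _) (hi _ _)
    rintro t ⟨h0, h1⟩
    unfold bh; rw [hcc]
    refine le_min ?_ (le_min le_rfl ?_)
    · gcongr
    · gcongr; linarith
  have e2 : ∫ t in c..(1-c), c ^ 2 * Lsq m r ≤ ∫ t in c..(1-c), bh m r k t := by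
    apply intervalIntegral.integral_mono_on (by linarith)
      (Continuous.intervalIntegrable (by fun_prop) _ _) (hi _ _)
    rintro t ⟨h0, h1⟩
    unfold bh; rw [hcc]
    refine le_min le_rfl (le_min ?_ ?_)
    · gcongr
    · gcongr; linarith
  have e3 : ∫ t in (1-c)..1, (1 - t) ^ 2 * Lsq m r ≤ ∫ t in (1-c)..1, bh m r k t := by
    apply intervalIntegral.integral_mono_on (by linarith)
      (Continuous.intervalIntegrable (by fun_prop) _ _) (hi _ _)
    rintro t ⟨h0, h1⟩
    unfold bh; rw [hcc]
    have : 0 ≤ 1 - t := by linarith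
    refine le_min ?_ (le_min ?_ le_rfl)
    · gcongr; linarith
    · gcongr; linarith
  rw [intervalIntegral.integral_comp_sub_left (fun t => t ^ 2 * Lsq m r) 1] at e3
  rw [intervalIntegral.integral_mul_const, integral_pow] at e1 e3
  rw [intervalIntegral.integral_const, smul_eq_mul] at e2
  norm_num at e1 e2 e3
  have hf : Lsq m r / (4 * (k:ℝ) ^ 2) * (1 - 2 / (3 * k)) =
      c ^ 3 / 3 * Lsq m r + ((1 - c - c) * (c ^ 2 * Lsq m r) + c ^ 3 / 3 * Lsq m r) := by
    rw [hc]; field_simp; ring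
  rw [hf]
  linarith

theorem lower_bound (m : ℕ) (hm : 3 ≤ m) (r : ℝ) (hr : 0 < r) (k : ℕ) (hk : 1 ≤ k)
    (α : Set (ℝ × ℝ)) (hα : α.Finite) (hc : α.ncard ≤ m * (k - 1)) :
    Lsq m r / (12 * (k:ℝ) ^ 2) ≤ distortion2 (polyUniform m r) (α ∪ vtx m r '' Set.Icc 1 m) := by
  have hk1 : (1:ℝ) ≤ k := by exact_mod_cast hk
  have hm3 : (3:ℝ) ≤ m := by exact_mod_cast hm
  have hk0 : (0:ℝ) < k := by linarith
  have hm0 : (0:ℝ) < m := by linarith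
  have hL0 : 0 ≤ Lsq m r := by unfold Lsq; positivity
  have hfin : (α ∪ vtx m r '' Set.Icc 1 m).Finite := hα.union ((Set.finite_Icc _ _).image _)
  have hne : (α ∪ vtx m r '' Set.Icc 1 m).Nonempty :=
    ⟨vtx m r 1, Or.inr ⟨1, ⟨le_rfl, by omega⟩, rfl⟩⟩
  have hcont := finf_cont hfin hne
  unfold distortion2
  rw [poly_integral m hm r _ hcont]
  have hgc := fun a j => gain_cont m r k a j
  -- pointwise
  have hpt : ∀ j ∈ Finset.Icc 1 m, ∀ t ∈ Set.Icc (0:ℝ) 1,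
      bh m r k t - ∑ a ∈ hα.toFinset, gain m r k a j t ≤
        sInf (sqDist (gam m r j t) '' (α ∪ vtx m r '' Set.Icc 1 m)) := by
    intro j hj t ht
    rw [Finset.mem_Icc] at hj
    have hnn : ∀ a, 0 ≤ gain m r k a j t := fun a => le_max_right _ _
    obtain ⟨a, ha, he⟩ := finf_mem hfin hne (gam m r j t)
    rw [← he]
    rcases ha with ha | ⟨l, hl, rfl⟩
    · have h1 : gain m r k a j t ≤ ∑ a ∈ hα.toFinset, gain m r k a j t :=
        Finset.single_le_sum (f := fun a => gain m r k a j t) (fun a _ => hnn a) (by simpa using ha)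
      have h2 : bh m r k t - sqDist (gam m r j t) a ≤ gain m r k a j t := le_max_left _ _
      linarith
    · have h1 := Finset.sum_nonneg (s := hα.toFinset) (fun a _ => hnn a)
      have h2 := sqDist_gam_vtx m hm r j l hj hl t ht
      have h3 : bh m r k t ≤ min (t ^ 2 * Lsq m r) ((1 - t) ^ 2 * Lsq m r) := min_le_right _ _
      linarith
  have hint : ∀ j ∈ Finset.Icc 1 m, (∫ t in (0:ℝ)..1, bh m r k t) -
      ∑ a ∈ hα.toFinset, ∫ t in (0:ℝ)..1, gain m r k a j t ≤
      ∫ t in (0:ℝ)..1, sInf (sqDist (gam m r j t) '' (α ∪ vtx m r '' Set.Icc 1 m)) := by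
    intro j hj
    have hb := bh_cont m r k
    rw [← intervalIntegral.integral_finsetSum (fun a _ => (hgc a j).intervalIntegrable _ _),
      ← intervalIntegral.integral_sub (hb.intervalIntegrable _ _)
        ((continuous_finset_sum _ (fun a _ => hgc a j)).intervalIntegrable _ _)]
    apply intervalIntegral.integral_mono_on zero_le_one
      ((hb.sub (continuous_finset_sum _ (fun a _ => hgc a j))).intervalIntegrable _ _)
      ((hcont.comp (gam_cont m r j)).intervalIntegrable _ _)
    exact hpt j hj
  have hsum := Finset.sum_le_sum hint
  rw [Finset.sum_sub_distrib, Finset.sum_comm (s := Finset.Icc 1 m) (t := hα.toFinset)] at hsum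
  rw [Finset.sum_const, Nat.card_Icc, Nat.add_sub_cancel, nsmul_eq_mul] at hsum
  have hbi := bh_integral m r k hk
  have hg : ∑ a ∈ hα.toFinset, ∑ j ∈ Finset.Icc 1 m, ∫ t in (0:ℝ)..1, gain m r k a j t ≤
      (m * (k - 1) : ℝ) * (Lsq m r / (6 * (k:ℝ) ^ 3)) := by
    rw [Set.ncard_eq_toFinset_card α hα] at hc
    rcases Nat.lt_or_ge 1 k with h2 | h2
    · refine (Finset.sum_le_card_nsmul _ _ _ (fun a _ => key_gain m hm r hr k h2 a)).trans ?_
      rw [nsmul_eq_mul]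
      have : ((hα.toFinset.card : ℕ) : ℝ) ≤ m * (k - 1) := by
        have : ((hα.toFinset.card : ℕ) : ℝ) ≤ ((m * (k - 1) : ℕ) : ℝ) := by exact_mod_cast hc
        rwa [Nat.cast_mul, Nat.cast_sub hk, Nat.cast_one] at this
      gcongr
    · have hk' : k = 1 := by omega
      subst hk'
      have : hα.toFinset = ∅ := by
        rw [← Finset.card_eq_zero]; omega
      rw [this]; simp
  have hfinal : Lsq m r / (12 * (k:ℝ) ^ 2) = (1 / (m:ℝ)) *
      (m * (Lsq m r / (4 * (k:ℝ) ^ 2) * (1 - 2 / (3 * k))) - (m * (k - 1) : ℝ) * (Lsq m r / (6 * (k:ℝ) ^ 3))) := by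
    field_simp; ring
  rw [hfinal]
  have := mul_le_mul_of_nonneg_left hbi hm0.le
  apply mul_le_mul_of_nonneg_left _ (by positivity)
  linarith

theorem side_upper (F : ℝ → ℝ) (hF : Continuous F) (L : ℝ) (k : ℕ) (hk : 1 ≤ k)
    (h : ∀ i : ℕ, i ≤ k → ∀ t, F t ≤ (t - i / k) ^ 2 * L) :
    ∫ t in (0:ℝ)..1, F t ≤ L / (12 * (k:ℝ) ^ 2) := by
  have hk1 : (1:ℝ) ≤ k := by exact_mod_cast hk
  have hk0 : (0:ℝ) < k := by linarith
  have hs := intervalIntegral.sum_integral_adjacent_intervals (f := F) (μ := volume)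
    (a := fun i => (i:ℝ) / k) (n := k) (fun i _ => hF.intervalIntegrable _ _)
  simp only [Nat.cast_zero, zero_div, div_self hk0.ne'] at hs
  rw [← hs]
  have hq : ∀ a b c : ℝ, ∫ t in a..b, (t - c) ^ 2 * L = ((b - c) ^ 3 - (a - c) ^ 3) / 3 * L := by
    intro a b c
    rw [intervalIntegral.integral_comp_sub_right (fun t => t ^ 2 * L) c,
      intervalIntegral.integral_mul_const, integral_pow]
    norm_num
  have hb : ∀ i ∈ Finset.range k, ∫ t in ((i:ℝ)/k)..((i+1 : ℕ):ℝ)/k, F t ≤ L / (12 * (k:ℝ) ^ 3) := by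
    intro i hi
    rw [Finset.mem_range] at hi
    rw [← intervalIntegral.integral_add_adjacent_intervals
      (hF.intervalIntegrable ((i:ℝ)/k) ((i + 1/2)/k)) (hF.intervalIntegrable ((i + 1/2)/k) (((i+1:ℕ):ℝ)/k))]
    have a1 : ∫ t in ((i:ℝ)/k)..((i + 1/2)/k), F t ≤ ∫ t in ((i:ℝ)/k)..((i + 1/2)/k), (t - i / k) ^ 2 * L := by
      apply intervalIntegral.integral_mono_on (by gcongr; linarith) (hF.intervalIntegrable _ _)
        (Continuous.intervalIntegrable (by fun_prop) _ _)
      exact fun t _ => h i hi.le t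
    have a2 : ∫ t in ((i + 1/2)/k)..(((i+1:ℕ):ℝ)/k), F t ≤
        ∫ t in ((i + 1/2)/k)..(((i+1:ℕ):ℝ)/k), (t - ((i+1:ℕ):ℝ) / k) ^ 2 * L := by
      apply intervalIntegral.integral_mono_on (by push_cast; gcongr; norm_num) (hF.intervalIntegrable _ _)
        (Continuous.intervalIntegrable (by fun_prop) _ _)
      exact fun t _ => h (i+1) hi t
    rw [hq] at a1 a2
    have : L / (12 * (k:ℝ) ^ 3) = (((i + 1/2)/k - i / k) ^ 3 - ((i:ℝ)/k - i / k) ^ 3) / 3 * L +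
      ((((i+1:ℕ):ℝ)/k - ((i+1:ℕ):ℝ)/k) ^ 3 - ((i + 1/2)/k - ((i+1:ℕ):ℝ)/k) ^ 3) / 3 * L := by
      push_cast; field_simp; ring
    linarith
  refine (Finset.sum_le_card_nsmul _ _ _ hb).trans (le_of_eq ?_)
  rw [Finset.card_range, nsmul_eq_mul]; field_simp

/-- the optimal set -/
noncomputable def optSet (m : ℕ) (r : ℝ) (k : ℕ) : Set (ℝ × ℝ) :=
  ⋃ j ∈ Set.Icc 1 m,
    (fun i : ℕ =>
      vtx m r j + (((i : ℝ) - 1) / (k : ℝ)) • (vtx m r (j + 1) - vtx m r j)) '' Set.Icc 1 (k + 1)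

theorem optSet_finite (m : ℕ) (r : ℝ) (k : ℕ) : (optSet m r k).Finite :=
  (Set.finite_Icc 1 m).biUnion (fun _ _ => (Set.finite_Icc _ _).image _)

theorem sqDist_gam_gam (m : ℕ) (r : ℝ) (j : ℕ) (s t : ℝ) :
    sqDist (gam m r j t) (vtx m r j + s • (vtx m r (j+1) - vtx m r j)) = (t - s) ^ 2 * Lsq m r := by
  have h := sqDist_gam_left m r j 1
  unfold sqDist gam at *
  simp at h ⊢
  linear_combination (t - s) ^ 2 * h

theorem upper_bound (m : ℕ) (hm : 3 ≤ m) (r : ℝ) (k : ℕ) (hk : 1 ≤ k) :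
    distortion2 (polyUniform m r) (optSet m r k) ≤ Lsq m r / (12 * (k:ℝ) ^ 2) := by
  have hm0 : (0:ℝ) < m := by positivity
  have hfin := optSet_finite m r k
  have hmem : ∀ j ∈ Set.Icc 1 m, ∀ i ∈ Set.Icc 1 (k+1),
      vtx m r j + (((i : ℝ) - 1) / (k : ℝ)) • (vtx m r (j + 1) - vtx m r j) ∈ optSet m r k := by
    intro j hj i hi
    exact Set.mem_biUnion hj ⟨i, hi, rfl⟩
  have hne : (optSet m r k).Nonempty := ⟨_, hmem 1 ⟨le_rfl, by omega⟩ 1 ⟨le_rfl, by omega⟩⟩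
  have hcont := finf_cont hfin hne
  unfold distortion2
  rw [poly_integral m hm r _ hcont]
  have hb : ∀ j ∈ Finset.Icc 1 m, ∫ t in (0:ℝ)..1, sInf (sqDist (gam m r j t) '' optSet m r k) ≤
      Lsq m r / (12 * (k:ℝ) ^ 2) := by
    intro j hj
    rw [Finset.mem_Icc] at hj
    apply side_upper _ (hcont.comp (gam_cont m r j)) _ k hk
    intro i hi t
    have := finf_le hfin (hmem j hj (i+1) ⟨by omega, by omega⟩) (gam m r j t)
    rw [sqDist_gam_gam] at this
    simpa using this
  have := Finset.sum_le_card_nsmul _ _ _ hb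
  rw [Nat.card_Icc, Nat.add_sub_cancel, nsmul_eq_mul] at this
  rw [one_div, inv_mul_le_iff₀ hm0]
  exact this

theorem optSet_eq (m : ℕ) (hm : 3 ≤ m) (r : ℝ) (k : ℕ) (hk : 1 ≤ k) :
    ∃ α : Set (ℝ × ℝ), α.Finite ∧ α.ncard ≤ m * (k - 1) ∧
      optSet m r k = α ∪ vtx m r '' Set.Icc 1 m := by
  have hk0 : (k:ℝ) ≠ 0 := by positivity
  obtain ⟨G, hG⟩ : ∃ G : ℕ × ℕ → ℝ × ℝ, ∀ j i, G (j, i) =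
    vtx m r j + (((i : ℝ) - 1) / (k : ℝ)) • (vtx m r (j + 1) - vtx m r j) := 
    ⟨fun p => vtx m r p.1 + (((p.2 : ℝ) - 1) / (k : ℝ)) • (vtx m r (p.1 + 1) - vtx m r p.1),
      fun _ _ => rfl⟩
  refine ⟨G '' (↑(Finset.Icc 1 m ×ˢ Finset.Icc 2 k) : Set (ℕ × ℕ)), (Finset.finite_toSet _).image _, ?_, ?_⟩
  · refine (Set.ncard_image_le (Finset.finite_toSet _)).trans ?_
    rw [Set.ncard_coe_finset, Finset.card_product, Nat.card_Icc, Nat.card_Icc]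
    apply Nat.mul_le_mul <;> omega
  · ext x
    simp only [optSet, Set.mem_iUnion, Set.mem_union, Set.mem_image, Set.mem_Icc, Finset.coe_product,
      Finset.coe_Icc, Set.mem_prod, Prod.exists, ← hG]
    constructor
    · rintro ⟨j, hj, i, hi, rfl⟩
      by_cases h1 : i = 1
      · right; refine ⟨j, hj, ?_⟩; rw [hG, h1]; simp
      by_cases h2 : i = k + 1
      · right
        have hx : G (j, i) = vtx m r (j + 1) := by rw [hG, h2]; simp [hk0]
        rw [hx]
        by_cases h3 : j = m
        · refine ⟨1, ⟨le_rfl, by omega⟩, ?_⟩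
          rw [h3, add_comm m 1, vtx_periodic m hm]
        · exact ⟨j + 1, ⟨by omega, by omega⟩, rfl⟩
      · left; exact ⟨j, i, ⟨hj, by omega, by omega⟩, rfl⟩
    · rintro (⟨j, i, ⟨hj, hi⟩, rfl⟩ | ⟨j, hj, rfl⟩)
      · exact ⟨j, hj, i, ⟨by omega, by omega⟩, rfl⟩
      · exact ⟨j, hj, 1, ⟨le_rfl, by omega⟩, by rw [hG]; simp⟩

/-- Theorem 4.5 (case `q = 0`): for `n = mk`, the `n`-th conditional quantization error of the
uniform distribution on the boundary of the regular `m`-sided polygon with respect to the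
conditional set of all vertices equals `r² sin²(π/m)/(3k²)`, attained by the stated set. -/
theorem stmt15 (m : ℕ) (hm : 3 ≤ m) (r : ℝ) (hr : 0 < r) (k : ℕ) (hk : 1 ≤ k)
    (n : ℕ) (hn : n = m * k) :
    condQuantError2 (polyUniform m r) (vtx m r '' Set.Icc 1 m) n
      = r ^ 2 * Real.sin (Real.pi / m) ^ 2 / (3 * (k : ℝ) ^ 2)
    ∧ distortion2 (polyUniform m r)
        (⋃ j ∈ Set.Icc 1 m,
          (fun i : ℕ =>
            vtx m r j + (((i : ℝ) - 1) / (k : ℝ)) • (vtx m r (j + 1) - vtx m r j)) ''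
            Set.Icc 1 (k + 1))
      = r ^ 2 * Real.sin (Real.pi / m) ^ 2 / (3 * (k : ℝ) ^ 2) := by
  have hval : r ^ 2 * Real.sin (Real.pi / m) ^ 2 / (3 * (k : ℝ) ^ 2) = Lsq m r / (12 * (k:ℝ) ^ 2) := by
    have : (k:ℝ) ≠ 0 := by positivity
    unfold Lsq; field_simp; ring
  rw [hval]
  obtain ⟨α, hα, hc, he⟩ := optSet_eq m hm r k hk
  have hβ : (vtx m r '' Set.Icc 1 m).ncard = m := by
    rw [Set.ncard_image_of_injOn (vtx_inj m hm r hr), ← Finset.coe_Icc, Set.ncard_coe_finset,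
      Nat.card_Icc, Nat.add_sub_cancel]
  have hnb : n - (vtx m r '' Set.Icc 1 m).ncard = m * (k - 1) := by
    rw [hβ, hn, Nat.mul_sub, Nat.mul_one]
  have hopt : distortion2 (polyUniform m r) (optSet m r k) = Lsq m r / (12 * (k:ℝ) ^ 2) := by
    apply le_antisymm (upper_bound m hm r k hk)
    rw [he]
    exact lower_bound m hm r hr k hk α hα hc
  refine ⟨?_, hopt⟩
  unfold condQuantError2
  apply IsLeast.csInf_eq
  constructor
  · exact ⟨α, hα, hnb ▸ hc, by rw [← he, hopt]⟩
  · rintro v ⟨α', hα', hc', rfl⟩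
    exact lower_bound m hm r hr k hk α' hα' (hnb ▸ hc')
end

section
/- Let m ≥ 3, r > 0, and let P be the uniform distribution on the boundary of the regular m-sided polygon A_1A_2⋯A_m inscribed in the circle of radius r centered at the origin, where A_j = (r cos(2π(j−1)/m), r sin(2π(j−1)/m)). Let V_n(P) denote the n-th conditional unconstrained quantization error for P with respect to the conditional set β = {A_j : 1 ≤ j ≤ m} for n ≥ m. Then V_n(P) → 0 as n → ∞, and the conditional quantization coefficient for P exists as a finite positive number and equals (1/3)·m²r² sin²(π/m), i.e., lim_{n→∞} n²·V_n(P) = (1/3)·m²r² sin²(π/m). -/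
open MeasureTheory Set Filter

/-! ### Auxiliary lemmas -/

noncomputable def edgePt (p q : ℝ × ℝ) (t : ℝ) : ℝ × ℝ := (1 - t) • p + t • q

lemma edgePt_continuous (p q : ℝ × ℝ) : Continuous (edgePt p q) := by
  unfold edgePt; fun_prop

lemma sqDist_nonneg (p q : ℝ × ℝ) : 0 ≤ sqDist p q := by unfold sqDist; positivity

lemma sqDist_continuous (q : ℝ × ℝ) : Continuous (fun p => sqDist p q) := by
  unfold sqDist; fun_prop

lemma sqDist_edge (p q : ℝ × ℝ) (t u : ℝ) :
    sqDist (edgePt p q t) (edgePt p q u) = sqDist p q * (t - u) ^ 2 := by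
  simp [sqDist, edgePt]; ring

lemma sqDist_triangle (x y a : ℝ × ℝ) : sqDist x y ≤ 2 * (sqDist x a + sqDist y a) := by
  unfold sqDist
  nlinarith [sq_nonneg (x.1 - a.1 + (y.1 - a.1)), sq_nonneg (x.2 - a.2 + (y.2 - a.2))]

lemma sqDist_proj (p q a : ℝ × ℝ) (l : ℝ) (hl : 0 < l) (h : sqDist p q = l ^ 2) :
    ∃ t0 : ℝ, ∀ t, l ^ 2 * (t - t0) ^ 2 ≤ sqDist (edgePt p q t) a := by
  refine ⟨((a.1 - p.1) * (q.1 - p.1) + (a.2 - p.2) * (q.2 - p.2)) / l ^ 2, fun t => ?_⟩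
  set d := (a.1 - p.1) * (q.1 - p.1) + (a.2 - p.2) * (q.2 - p.2) with hd
  have h2 : 0 < l ^ 2 := by positivity
  have e : l ^ 2 * (t - d / l ^ 2) ^ 2 = l ^ 2 * t ^ 2 - 2 * t * d + d ^ 2 / l ^ 2 := by
    field_simp
    ring
  have cs : d ^ 2 / l ^ 2 ≤ (a.1 - p.1) ^ 2 + (a.2 - p.2) ^ 2 := by
    rw [div_le_iff₀ h2, ← h, hd]
    unfold sqDist
    nlinarith [sq_nonneg ((a.1 - p.1) * (q.2 - p.2) - (a.2 - p.2) * (q.1 - p.1))]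
  have e2 : sqDist (edgePt p q t) a
      = l ^ 2 * t ^ 2 - 2 * t * d + ((a.1 - p.1) ^ 2 + (a.2 - p.2) ^ 2) := by
    rw [← h, hd]; simp [sqDist, edgePt]; ring
  rw [e, e2]; linarith

lemma bump_integral (l ρ t0 : ℝ) (hl : 0 < l) (hρ : 0 < ρ) (M : Set ℝ) :
    Integrable (fun t : ℝ => max (ρ ^ 2 - l ^ 2 * (t - t0) ^ 2) 0) ∧
    ∫ t in M, max (ρ ^ 2 - l ^ 2 * (t - t0) ^ 2) 0 ≤ 4 * ρ ^ 3 / (3 * l) := by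
  have hle : t0 - ρ / l ≤ t0 + ρ / l := by
    have : 0 < ρ / l := by positivity
    linarith
  have key : (fun t : ℝ => max (ρ ^ 2 - l ^ 2 * (t - t0) ^ 2) 0)
      = (Set.Icc (t0 - ρ / l) (t0 + ρ / l)).indicator
          (fun t => ρ ^ 2 - l ^ 2 * (t - t0) ^ 2) := by
    funext t
    by_cases ht : t ∈ Set.Icc (t0 - ρ / l) (t0 + ρ / l)
    · rw [Set.indicator_of_mem ht]
      apply max_eq_left
      have h1 : |t - t0| ≤ ρ / l := by rw [abs_le]; constructor <;> linarith [ht.1, ht.2]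
      rw [le_div_iff₀ hl] at h1
      have h3 : 0 ≤ |t - t0| * l := by positivity
      have h4 : (|t - t0| * l) ^ 2 ≤ ρ ^ 2 := by gcongr
      rw [mul_pow, sq_abs] at h4
      linarith
    · rw [Set.indicator_of_notMem ht]
      apply max_eq_right
      have h1 : ρ / l ≤ |t - t0| := by
        by_contra! hc
        rw [abs_lt] at hc
        exact ht ⟨by linarith [hc.1], by linarith [hc.2]⟩
      rw [div_le_iff₀ hl] at h1
      have h4 : ρ ^ 2 ≤ (|t - t0| * l) ^ 2 := by gcongr
      rw [mul_pow, sq_abs] at h4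
      linarith
  have hint : Integrable (fun t : ℝ => max (ρ ^ 2 - l ^ 2 * (t - t0) ^ 2) 0) := by
    rw [key, integrable_indicator_iff measurableSet_Icc]
    apply ContinuousOn.integrableOn_Icc
    fun_prop
  refine ⟨hint, ?_⟩
  calc ∫ t in M, max (ρ ^ 2 - l ^ 2 * (t - t0) ^ 2) 0
      ≤ ∫ t, max (ρ ^ 2 - l ^ 2 * (t - t0) ^ 2) 0 :=
        setIntegral_le_integral hint (Eventually.of_forall fun t => le_max_right _ _)
    _ = ∫ t in (t0 - ρ / l)..(t0 + ρ / l), (ρ ^ 2 - l ^ 2 * (t - t0) ^ 2) := by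
        rw [key, integral_indicator measurableSet_Icc, integral_Icc_eq_integral_Ioc,
          intervalIntegral.integral_of_le hle]
    _ = 4 * ρ ^ 3 / (3 * l) := by
        rw [intervalIntegral.integral_comp_sub_right (fun t => ρ ^ 2 - l ^ 2 * t ^ 2) t0,
          intervalIntegral.integral_sub (by simp)
            (Continuous.intervalIntegrable (by fun_prop) _ _),
          intervalIntegral.integral_const_mul, integral_pow]
        simp
        field_simp
        ring
    _ ≤ _ := le_rfl

lemma minDist_nonneg (x : ℝ × ℝ) (s : Set (ℝ × ℝ)) : 0 ≤ sInf (sqDist x '' s) := by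
  apply Real.sInf_nonneg
  rintro _ ⟨y, -, rfl⟩
  exact sqDist_nonneg _ _

lemma minDist_le (x a : ℝ × ℝ) (s : Set (ℝ × ℝ)) (ha : a ∈ s) :
    sInf (sqDist x '' s) ≤ sqDist x a := by
  apply csInf_le
  · refine ⟨0, ?_⟩
    rintro _ ⟨y, -, rfl⟩
    exact sqDist_nonneg _ _
  · exact ⟨a, ha, rfl⟩

lemma minDist_continuous (s : Set (ℝ × ℝ)) (hs : s.Finite) (hne : s.Nonempty) :
    Continuous (fun x => sInf (sqDist x '' s)) := by
  lift s to Finset (ℝ × ℝ) using hs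
  have hne' : s.Nonempty := by simpa using hne
  have : (fun x => sInf (sqDist x '' (s : Set (ℝ × ℝ)))) = fun x => s.inf' hne' (sqDist x) := by
    funext x
    rw [Finset.inf'_eq_csInf_image]
  rw [this]
  apply Continuous.finset_inf'_apply
  intro a _
  exact sqDist_continuous a

lemma minDist_lower (x : ℝ × ℝ) (S : Finset (ℝ × ℝ)) (hne : S.Nonempty) (ρ : ℝ) :
    ρ ^ 2 - ∑ a ∈ S, max (ρ ^ 2 - sqDist x a) 0 ≤ sInf (sqDist x '' (S : Set (ℝ × ℝ))) := by
  apply le_csInf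
  · exact (Finset.coe_nonempty.mpr hne).image _
  · rintro _ ⟨a, ha, rfl⟩
    have h1 := Finset.single_le_sum (f := fun a => max (ρ ^ 2 - sqDist x a) 0)
      (fun i _ => le_max_right _ _) (Finset.mem_coe.mp ha)
    have h2 := le_max_left (ρ ^ 2 - sqDist x a) 0
    linarith

lemma uniformOn01 : uniformOn 0 1 = volume.restrict (Set.Icc (0:ℝ) 1) := by
  simp [uniformOn]

lemma distortion_eq (m : ℕ) (r : ℝ) (s : Set (ℝ × ℝ)) (hs : s.Finite) (hne : s.Nonempty) :
    distortion2 (polyUniform m r) s = (m : ℝ)⁻¹ * ∑ j ∈ Finset.Icc 1 m,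
      ∫ t in Set.Icc (0:ℝ) 1, sInf (sqDist (edgePt (vtx m r j) (vtx m r (j+1)) t) '' s) := by
  have hc := minDist_continuous s hs hne
  unfold distortion2 polyUniform
  rw [integral_smul_measure, integral_finsetSum_measure]
  · simp only [ENNReal.toReal_inv, ENNReal.toReal_natCast, smul_eq_mul]
    congr 1
    apply Finset.sum_congr rfl
    intro j _
    rw [uniformOn01]
    exact integral_map (edgePt_continuous _ _).measurable.aemeasurable
      hc.aestronglyMeasurable
  · intro j _
    rw [uniformOn01]
    refine (integrable_map_measure hc.aestronglyMeasurable
      (edgePt_continuous _ _).measurable.aemeasurable).mpr ?_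
    exact (hc.comp (edgePt_continuous (vtx m r j) (vtx m r (j+1)))).continuousOn.integrableOn_Icc

lemma vtx_side (m : ℕ) (hm : 3 ≤ m) (r : ℝ) (j : ℕ) :
    sqDist (vtx m r j) (vtx m r (j+1)) = (2 * r * Real.sin (Real.pi / m)) ^ 2 := by
  have hm0 : (m : ℝ) ≠ 0 := by positivity
  set h := Real.pi / m with hh
  have e1 : 2 * Real.pi * ((j : ℝ) - 1) / m = (2 * j - 1) * h - h := by
    rw [hh]; field_simp; ring
  have e2 : 2 * Real.pi * (((j + 1 : ℕ) : ℝ) - 1) / m = (2 * j - 1) * h + h := by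
    rw [hh]; push_cast; field_simp; ring
  unfold sqDist vtx
  simp only
  rw [e1, e2, Real.cos_sub, Real.cos_add, Real.sin_sub, Real.sin_add]
  linear_combination (4 * r ^ 2 * Real.sin h ^ 2) * Real.sin_sq_add_cos_sq ((2 * j - 1) * h)

lemma cos_lt_of_mid (h θ : ℝ) (h0 : 0 < h) (h1 : h < θ) (h2 : θ < 2 * Real.pi - h) :
    Real.cos θ < Real.cos h := by
  rcases le_total θ Real.pi with hp | hp
  · exact Real.cos_lt_cos_of_nonneg_of_le_pi h0.le hp h1
  · rw [← Real.cos_two_pi_sub θ]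
    exact Real.cos_lt_cos_of_nonneg_of_le_pi h0.le (by linarith) (by linarith)

lemma cos_le_of_mid (h θ : ℝ) (h0 : 0 < h) (h1 : h ≤ θ) (h2 : θ ≤ 2 * Real.pi - h) :
    Real.cos θ ≤ Real.cos h := by
  rcases h1.lt_or_eq with h1 | h1
  · rcases h2.lt_or_eq with h2 | h2
    · exact (cos_lt_of_mid h θ h0 h1 h2).le
    · rw [h2, Real.cos_two_pi_sub]
  · rw [h1]

lemma edges_disjoint (m : ℕ) (hm : 3 ≤ m) (r : ℝ) (hr : 0 < r) (i j : ℕ) (hi : 1 ≤ i)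
    (hij : i < j) (hj : j ≤ m) (t u : ℝ) (ht : t ∈ Set.Ioo (0:ℝ) 1) :
    edgePt (vtx m r i) (vtx m r (i+1)) t ≠ edgePt (vtx m r j) (vtx m r (j+1)) u := by
  intro heq
  have hm0 : (m : ℝ) ≠ 0 := by positivity
  set h := Real.pi / m with hh
  have hpi : Real.pi = m * h := by rw [hh]; field_simp
  have h0 : 0 < h := by rw [hh]; positivity
  -- inner product with the normal of the edge `j`
  have inner_v : ∀ k : ℕ, (vtx m r k).1 * Real.cos ((2 * j - 1) * h)
      + (vtx m r k).2 * Real.sin ((2 * j - 1) * h)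
      = r * Real.cos ((2 * j - 2 * k + 1) * h) := by
    intro k
    have e1 : (2 * (j:ℝ) - 2 * k + 1) * h
        = (2 * j - 1) * h - 2 * Real.pi * ((k : ℝ) - 1) / m := by
      rw [hh]; field_simp; ring
    rw [e1, Real.cos_sub]
    unfold vtx
    simp only
    ring
  have a1 := inner_v i
  have a2 := inner_v (i+1)
  have a3 := inner_v j
  have a4 := inner_v (j+1)
  have e3 : (2 * (j:ℝ) - 2 * j + 1) * h = h := by ring
  have e4 : (2 * (j:ℝ) - 2 * ((j+1 : ℕ) : ℝ) + 1) * h = -h := by push_cast; ring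
  rw [e3] at a3
  rw [e4, Real.cos_neg] at a4
  have q1 := congrArg Prod.fst heq
  have q2 := congrArg Prod.snd heq
  simp only [edgePt, Prod.fst_add, Prod.snd_add, Prod.smul_fst, Prod.smul_snd, smul_eq_mul] at q1 q2
  have main : (1 - t) * (r * Real.cos ((2 * (j:ℝ) - 2 * i + 1) * h))
      + t * (r * Real.cos ((2 * (j:ℝ) - 2 * ((i+1 : ℕ) : ℝ) + 1) * h)) = r * Real.cos h := by
    linear_combination (-(1-t)) * a1 - t * a2 + (1 - u) * a3 + u * a4
      + Real.cos ((2 * j - 1) * h) * q1 + Real.sin ((2 * j - 1) * h) * q2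
  have c1 : (i:ℝ) + 1 ≤ j := by exact_mod_cast hij
  have c2 : (j:ℝ) + 1 ≤ m + i := by exact_mod_cast (by omega : j + 1 ≤ m + i)
  have hm3 : (3:ℝ) ≤ m := by exact_mod_cast hm
  have lo : ∀ c : ℝ, 1 ≤ c → h ≤ c * h := fun c hc => le_mul_of_one_le_left h0.le hc
  have loStrict : ∀ c : ℝ, 1 < c → h < c * h := fun c hc => lt_mul_of_one_lt_left h0 hc
  have hiWeak : ∀ c : ℝ, c ≤ 2 * m - 1 → c * h ≤ 2 * Real.pi - h := fun c hc => by
    have := mul_le_mul_of_nonneg_right hc h0.le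
    rw [hpi]; linarith
  have hiStrict : ∀ c : ℝ, c < 2 * m - 1 → c * h < 2 * Real.pi - h := fun c hc => by
    have := mul_lt_mul_of_pos_right hc h0
    rw [hpi]; linarith
  have L1 : Real.cos ((2 * (j:ℝ) - 2 * i + 1) * h) ≤ Real.cos h := by
    apply cos_le_of_mid h _ h0
    · exact lo _ (by linarith)
    · exact hiWeak _ (by linarith)
  have L2 : Real.cos ((2 * (j:ℝ) - 2 * ((i+1 : ℕ) : ℝ) + 1) * h) ≤ Real.cos h := by
    apply cos_le_of_mid h _ h0
    · exact lo _ (by push_cast; linarith)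
    · exact hiWeak _ (by push_cast; linarith)
  have t0 := ht.1
  have t1 : 0 < 1 - t := by linarith [ht.2]
  have L3 : Real.cos ((2 * (j:ℝ) - 2 * i + 1) * h) < Real.cos h ∨
      Real.cos ((2 * (j:ℝ) - 2 * ((i+1 : ℕ) : ℝ) + 1) * h) < Real.cos h := by
    rcases Nat.lt_or_ge (i+1) j with hlt | hge
    · right
      have c3 : (i:ℝ) + 2 ≤ j := by exact_mod_cast hlt
      apply cos_lt_of_mid h _ h0
      · exact loStrict _ (by push_cast; linarith)
      · exact hiStrict _ (by push_cast; linarith)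
    · left
      have c3 : (j:ℝ) = i + 1 := by exact_mod_cast (by omega : j = i + 1)
      rw [c3]
      apply cos_lt_of_mid h _ h0
      · exact loStrict _ (by linarith)
      · exact hiStrict _ (by linarith)
  rcases L3 with L | L
  · have := mul_lt_mul_of_pos_left (mul_lt_mul_of_pos_left L hr) t1
    have := mul_le_mul_of_nonneg_left (mul_le_mul_of_nonneg_left L2 hr.le) t0.le
    linarith
  · have := mul_lt_mul_of_pos_left (mul_lt_mul_of_pos_left L hr) t0
    have := mul_le_mul_of_nonneg_left (mul_le_mul_of_nonneg_left L1 hr.le) t1.le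
    linarith

lemma sqDist_pos (p q : ℝ × ℝ) (h : p ≠ q) : 0 < sqDist p q := by
  rcases (sqDist_nonneg p q).lt_or_eq with h1 | h1
  · exact h1
  · exfalso
    apply h
    unfold sqDist at h1
    have a := sq_nonneg (p.1 - q.1)
    have b := sq_nonneg (p.2 - q.2)
    have aSq : (p.1 - q.1) ^ 2 = 0 := by linarith
    have bSq : (p.2 - q.2) ^ 2 = 0 := by linarith
    have aZero := pow_eq_zero_iff (two_ne_zero) |>.mp aSq
    have bZero := pow_eq_zero_iff (two_ne_zero) |>.mp bSq
    exact Prod.ext (by linarith) (by linarith)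

lemma edges_sep (m : ℕ) (hm : 3 ≤ m) (r : ℝ) (hr : 0 < r) (δ : ℝ) (hδ : 0 < δ)
    (hδ2 : δ < 1 / 2) : ∃ η > 0, ∀ i ∈ Finset.Icc 1 m, ∀ j ∈ Finset.Icc 1 m, i ≠ j →
      ∀ t ∈ Set.Icc δ (1 - δ), ∀ u ∈ Set.Icc δ (1 - δ),
      η ≤ sqDist (edgePt (vtx m r i) (vtx m r (i+1)) t) (edgePt (vtx m r j) (vtx m r (j+1)) u) := by
  have hI : ∀ t ∈ Set.Icc δ (1 - δ), t ∈ Set.Ioo (0:ℝ) 1 := fun t ht =>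
    ⟨by linarith [ht.1], by linarith [ht.2]⟩
  have hne : ∀ i ∈ Finset.Icc 1 m, ∀ j ∈ Finset.Icc 1 m, i ≠ j →
      ∀ t ∈ Set.Icc δ (1 - δ), ∀ u ∈ Set.Icc δ (1 - δ),
      edgePt (vtx m r i) (vtx m r (i+1)) t ≠ edgePt (vtx m r j) (vtx m r (j+1)) u := by
    intro i hi j hj hij t ht u hu
    rw [Finset.mem_Icc] at hi hj
    rcases lt_or_gt_of_ne hij with h | h
    · exact edges_disjoint m hm r hr i j hi.1 h hj.2 t u (hI t ht)
    · exact (edges_disjoint m hm r hr j i hj.1 h hi.2 u t (hI u hu)).symm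
  have ev : ∀ᶠ η in nhdsWithin (0:ℝ) (Set.Ioi 0), ∀ i ∈ Finset.Icc 1 m, ∀ j ∈ Finset.Icc 1 m,
      i ≠ j → ∀ t ∈ Set.Icc δ (1 - δ), ∀ u ∈ Set.Icc δ (1 - δ),
      η ≤ sqDist (edgePt (vtx m r i) (vtx m r (i+1)) t)
        (edgePt (vtx m r j) (vtx m r (j+1)) u) := by
    rw [Filter.eventually_all_finset]
    intro i hi
    rw [Filter.eventually_all_finset]
    intro j hj
    by_cases hij : i = j
    · simp [hij]
    have hcont : Continuous (fun z : ℝ × ℝ => sqDist (edgePt (vtx m r i) (vtx m r (i+1)) z.1)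
        (edgePt (vtx m r j) (vtx m r (j+1)) z.2)) := by
      unfold sqDist edgePt; fun_prop
    obtain ⟨z, hz, hmin⟩ := (isCompact_Icc.prod isCompact_Icc :
      IsCompact (Set.Icc δ (1 - δ) ×ˢ Set.Icc δ (1 - δ))).exists_isMinOn
      ⟨(δ, δ), ⟨⟨le_rfl, by linarith⟩, ⟨le_rfl, by linarith⟩⟩⟩ hcont.continuousOn
    have hpos := sqDist_pos _ _ (hne i hi j hj hij z.1 hz.1 z.2 hz.2)
    filter_upwards [Ioo_mem_nhdsGT hpos] with η hη _ t ht u hu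
    exact hη.2.le.trans (hmin (show (t, u) ∈ Set.Icc δ (1 - δ) ×ˢ Set.Icc δ (1 - δ) from ⟨ht, hu⟩))
  obtain ⟨η, h1, h2⟩ := (ev.and self_mem_nhdsWithin).exists
  exact ⟨η, h2, h1⟩

lemma one_point_bound (m : ℕ) (hm : 3 ≤ m) (r l : ℝ) (hl : 0 < l)
    (hlr : l = 2 * r * Real.sin (Real.pi / m)) (δ η ρ : ℝ) (hρ : 0 < ρ) (hηρ : 4 * ρ ^ 2 ≤ η)
    (hsep : ∀ i ∈ Finset.Icc 1 m, ∀ j ∈ Finset.Icc 1 m, i ≠ j →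
      ∀ t ∈ Set.Icc δ (1 - δ), ∀ u ∈ Set.Icc δ (1 - δ),
      η ≤ sqDist (edgePt (vtx m r i) (vtx m r (i+1)) t) (edgePt (vtx m r j) (vtx m r (j+1)) u))
    (a : ℝ × ℝ) :
    ∑ j ∈ Finset.Icc 1 m, ∫ t in Set.Icc δ (1 - δ),
      max (ρ ^ 2 - sqDist (edgePt (vtx m r j) (vtx m r (j+1)) t) a) 0 ≤ 4 * ρ ^ 3 / (3 * l) := by
  by_cases hex : ∃ i ∈ Finset.Icc 1 m, ∃ t ∈ Set.Icc δ (1 - δ),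
      sqDist (edgePt (vtx m r i) (vtx m r (i+1)) t) a < ρ ^ 2
  · obtain ⟨i, hi, t, ht, hlt⟩ := hex
    rw [Finset.sum_eq_single_of_mem i hi]
    · obtain ⟨t0, h0⟩ := sqDist_proj (vtx m r i) (vtx m r (i+1)) a l hl
        (by rw [vtx_side m hm, hlr])
      obtain ⟨b1, b2⟩ := bump_integral l ρ t0 hl hρ (Set.Icc δ (1 - δ))
      refine le_trans (integral_mono ?_ b1.integrableOn ?_) b2
      · apply Continuous.integrableOn_Icc
        exact (continuous_const.sub ((sqDist_continuous a).comp (edgePt_continuous _ _))).max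
          continuous_const
      · intro u
        have := h0 u
        simp only
        gcongr
    · intro j hj hji
      apply setIntegral_eq_zero_of_forall_eq_zero
      intro u hu
      apply max_eq_right
      have := hsep i hi j hj hji.symm t ht u hu
      have := sqDist_triangle (edgePt (vtx m r i) (vtx m r (i+1)) t)
        (edgePt (vtx m r j) (vtx m r (j+1)) u) a
      linarith
  · push Not at hex
    rw [Finset.sum_eq_zero]
    · positivity
    · intro j hj
      apply setIntegral_eq_zero_of_forall_eq_zero
      intro u hu
      apply max_eq_right
      linarith [hex j hj u hu]

lemma distortion_lower (m : ℕ) (hm : 3 ≤ m) (r l : ℝ) (hl : 0 < l)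
    (hlr : l = 2 * r * Real.sin (Real.pi / m)) (δ η ρ : ℝ) (hδ : 0 < δ)
    (hδ2 : δ < 1 / 2) (hρ : 0 < ρ) (hηρ : 4 * ρ ^ 2 ≤ η)
    (hsep : ∀ i ∈ Finset.Icc 1 m, ∀ j ∈ Finset.Icc 1 m, i ≠ j →
      ∀ t ∈ Set.Icc δ (1 - δ), ∀ u ∈ Set.Icc δ (1 - δ),
      η ≤ sqDist (edgePt (vtx m r i) (vtx m r (i+1)) t) (edgePt (vtx m r j) (vtx m r (j+1)) u))
    (S : Finset (ℝ × ℝ)) (hne : S.Nonempty) :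
    (1 - 2 * δ) * ρ ^ 2 - S.card * (4 * ρ ^ 3 / (3 * (m * l)))
      ≤ distortion2 (polyUniform m r) S := by
  have hm0 : (0 : ℝ) < m := by positivity
  rw [distortion_eq m r S S.finite_toSet (by simpa using hne)]
  set f : ℕ → ℝ → (ℝ × ℝ) → ℝ := fun j t a =>
    max (ρ ^ 2 - sqDist (edgePt (vtx m r j) (vtx m r (j+1)) t) a) 0 with hf
  have hfi : ∀ j a, IntegrableOn (fun t => f j t a) (Set.Icc δ (1 - δ)) := by
    intro j a
    apply Continuous.integrableOn_Icc
    exact (continuous_const.sub ((sqDist_continuous a).comp (edgePt_continuous _ _))).max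
          continuous_const
  have step : ∀ j ∈ Finset.Icc 1 m, (1 - 2 * δ) * ρ ^ 2
      - ∑ a ∈ S, ∫ t in Set.Icc δ (1 - δ), f j t a ≤
      ∫ t in Set.Icc (0:ℝ) 1,
        sInf (sqDist (edgePt (vtx m r j) (vtx m r (j+1)) t) '' (S : Set (ℝ × ℝ))) := by
    intro j _
    have hc : Continuous (fun t => sInf (sqDist (edgePt (vtx m r j) (vtx m r (j+1)) t) ''
        (S : Set (ℝ × ℝ)))) := (minDist_continuous (S : Set (ℝ × ℝ)) S.finite_toSet
          (by simpa using hne)).comp (edgePt_continuous _ _)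
    calc (1 - 2 * δ) * ρ ^ 2 - ∑ a ∈ S, ∫ t in Set.Icc δ (1 - δ), f j t a
        = ∫ t in Set.Icc δ (1 - δ), (ρ ^ 2 - ∑ a ∈ S, f j t a) := by
          rw [integral_sub (by simp) (integrable_finsetSum _ fun a _ => hfi j a),
            integral_finsetSum _ fun a _ => hfi j a, setIntegral_const]
          congr 1
          rw [Real.volume_real_Icc_of_le (by linarith), smul_eq_mul]
          ring
      _ ≤ ∫ t in Set.Icc δ (1 - δ),
          sInf (sqDist (edgePt (vtx m r j) (vtx m r (j+1)) t) '' (S : Set (ℝ × ℝ))) := by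
          apply integral_mono
          · exact (integrable_const _).sub (integrable_finsetSum _ fun a _ => hfi j a)
          · exact hc.integrableOn_Icc
          · intro t
            exact minDist_lower _ S hne ρ
      _ ≤ _ := by
          apply setIntegral_mono_set hc.integrableOn_Icc
          · exact Eventually.of_forall fun t => minDist_nonneg _ _
          · exact (Set.Icc_subset_Icc hδ.le (by linarith)).eventuallyLE
  have tot := Finset.sum_le_sum step
  rw [Finset.sum_sub_distrib, Finset.sum_const, Nat.card_Icc, Finset.sum_comm] at tot
  have b : ∑ a ∈ S, ∑ j ∈ Finset.Icc 1 m, ∫ t in Set.Icc δ (1 - δ), f j t a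
      ≤ S.card * (4 * ρ ^ 3 / (3 * l)) := by
    rw [← nsmul_eq_mul]
    apply Finset.sum_le_card_nsmul
    intro a _
    exact one_point_bound m hm r l hl hlr δ η ρ hρ hηρ hsep a
  rw [nsmul_eq_mul, Nat.add_sub_cancel] at tot
  rw [inv_mul_eq_div, le_div_iff₀ hm0]
  have e : (S.card : ℝ) * (4 * ρ ^ 3 / (3 * (m * l))) * m = S.card * (4 * ρ ^ 3 / (3 * l)) := by
    field_simp
  rw [sub_mul, e]
  linarith

lemma edge_upper (p q : ℝ × ℝ) (l : ℝ) (h : sqDist p q = l ^ 2) (k : ℕ) (hk : 0 < k)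
    (s : Set (ℝ × ℝ)) (hs : s.Finite)
    (hmem : ∀ i < k, edgePt p q ((2 * i + 1) / (2 * k)) ∈ s) :
    ∫ t in Set.Icc (0:ℝ) 1, sInf (sqDist (edgePt p q t) '' s) ≤ l ^ 2 / (12 * k ^ 2) := by
  have hk0 : (0:ℝ) < k := by exact_mod_cast hk
  have hc : Continuous (fun t => sInf (sqDist (edgePt p q t) '' s)) :=
    (minDist_continuous s hs ⟨_, hmem 0 hk⟩).comp (edgePt_continuous _ _)
  have hsum := intervalIntegral.sum_integral_adjacent_intervals (μ := volume)
    (f := fun t => sInf (sqDist (edgePt p q t) '' s)) (a := fun i : ℕ => (i:ℝ) / k) (n := k)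
    (fun i _ => hc.intervalIntegrable _ _)
  rw [integral_Icc_eq_integral_Ioc, ← intervalIntegral.integral_of_le zero_le_one]
  simp only [Nat.cast_zero, zero_div, div_self hk0.ne'] at hsum
  rw [← hsum]
  have : ∀ i ∈ Finset.range k, ∫ t in ((i:ℝ) / k)..(((i + 1 : ℕ) : ℝ) / k),
      sInf (sqDist (edgePt p q t) '' s) ≤ l ^ 2 / (12 * k ^ 3) := by
    intro i hi
    calc ∫ t in ((i:ℝ) / k)..(((i + 1 : ℕ) : ℝ) / k), sInf (sqDist (edgePt p q t) '' s)
        ≤ ∫ t in ((i:ℝ) / k)..(((i + 1 : ℕ) : ℝ) / k), l ^ 2 * (t - (2 * i + 1) / (2 * k)) ^ 2 := by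
          apply intervalIntegral.integral_mono_on
          · gcongr; simp
          · exact hc.intervalIntegrable _ _
          · exact Continuous.intervalIntegrable (by fun_prop) _ _
          · intro t _
            have := minDist_le (edgePt p q t) _ s (hmem i (Finset.mem_range.mp hi))
            rwa [sqDist_edge, h] at this
      _ = l ^ 2 / (12 * k ^ 3) := by
          rw [intervalIntegral.integral_const_mul,
            intervalIntegral.integral_comp_sub_right (fun t => t ^ 2), integral_pow]
          push_cast
          field_simp
          ring
  refine (Finset.sum_le_card_nsmul _ _ _ this).trans (le_of_eq ?_)
  rw [Finset.card_range, nsmul_eq_mul]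
  field_simp

lemma exists_upper (m : ℕ) (hm : 3 ≤ m) (r : ℝ) (k : ℕ) (hk : 0 < k)
    (β : Set (ℝ × ℝ)) (hβ : β.Finite) :
    ∃ α : Set (ℝ × ℝ), α.Finite ∧ α.ncard ≤ m * k ∧
      distortion2 (polyUniform m r) (α ∪ β)
        ≤ (2 * r * Real.sin (Real.pi / m)) ^ 2 / (12 * k ^ 2) := by
  classical
  have hm0 : (0 : ℝ) < m := by positivity
  set T : Finset (ℝ × ℝ) := (Finset.Icc 1 m ×ˢ Finset.range k).image
    (fun z => edgePt (vtx m r z.1) (vtx m r (z.1+1)) ((2 * (z.2 : ℝ) + 1) / (2 * k))) with hT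
  have hmem : ∀ j ∈ Finset.Icc 1 m, ∀ i < k,
      edgePt (vtx m r j) (vtx m r (j+1)) ((2 * (i : ℝ) + 1) / (2 * k)) ∈ (T : Set (ℝ × ℝ)) ∪ β := by
    intro j hj i hi
    left
    rw [Finset.mem_coe, hT, Finset.mem_image]
    exact ⟨(j, i), Finset.mem_product.mpr ⟨hj, Finset.mem_range.mpr hi⟩, rfl⟩
  have hfin : ((T : Set (ℝ × ℝ)) ∪ β).Finite := T.finite_toSet.union hβ
  refine ⟨T, T.finite_toSet, ?_, ?_⟩
  · rw [Set.ncard_coe_finset]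
    refine Finset.card_image_le.trans ?_
    simp
  · rw [distortion_eq m r _ hfin ⟨_, hmem 1 (by simp; omega) 0 hk⟩]
    rw [inv_mul_eq_div, div_le_iff₀ hm0]
    have := Finset.sum_le_card_nsmul (Finset.Icc 1 m) (fun j => ∫ t in Set.Icc (0:ℝ) 1,
      sInf (sqDist (edgePt (vtx m r j) (vtx m r (j+1)) t) '' ((T : Set (ℝ × ℝ)) ∪ β))) _
      (fun j hj => edge_upper _ _ _ (vtx_side m hm r j) k hk _ hfin (hmem j hj))
    rw [Nat.card_Icc, Nat.add_sub_cancel, nsmul_eq_mul] at this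
    linarith

lemma quant_upper (m : ℕ) (hm : 3 ≤ m) (r : ℝ) (n k : ℕ) (hk : 0 < k)
    (β : Set (ℝ × ℝ)) (hβ : β.Finite) (hn : m * k ≤ n - β.ncard) :
    condQuantError2 (polyUniform m r) β n
        ≤ (2 * r * Real.sin (Real.pi / m)) ^ 2 / (12 * k ^ 2) := by
  obtain ⟨α, h1, h2, h3⟩ := exists_upper m hm r k hk β hβ
  refine le_trans (csInf_le ?_ ⟨α, h1, h2.trans hn, rfl⟩) h3
  refine ⟨0, ?_⟩
  rintro _ ⟨α, -, -, rfl⟩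
  exact integral_nonneg fun x => minDist_nonneg _ _

lemma quant_lower (m : ℕ) (hm : 3 ≤ m) (r l : ℝ) (hl : 0 < l)
    (hlr : l = 2 * r * Real.sin (Real.pi / m)) (δ η : ℝ) (hδ : 0 < δ)
    (hδ2 : δ < 1 / 2)
    (hsep : ∀ i ∈ Finset.Icc 1 m, ∀ j ∈ Finset.Icc 1 m, i ≠ j →
      ∀ t ∈ Set.Icc δ (1 - δ), ∀ u ∈ Set.Icc δ (1 - δ),
      η ≤ sqDist (edgePt (vtx m r i) (vtx m r (i+1)) t) (edgePt (vtx m r j) (vtx m r (j+1)) u))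
    (β : Set (ℝ × ℝ)) (hβ : β.Finite) (hβne : β.Nonempty) (n : ℕ) (hn : β.ncard ≤ n)
    (hn0 : 0 < n)
    (hηρ : 4 * (m * l / (2 * n)) ^ 2 ≤ η) :
    (m * l) ^ 2 * (1 / 12 - δ / 2) / n ^ 2 ≤ condQuantError2 (polyUniform m r) β n := by
  have hm0 : (0 : ℝ) < m := by positivity
  have hn' : (0 : ℝ) < n := by exact_mod_cast hn0
  apply le_csInf
  · exact ⟨_, ∅, Set.finite_empty, by simp, rfl⟩
  · rintro _ ⟨α, hα, hcard, rfl⟩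
    have hfin := hα.union hβ
    have hc : hfin.toFinset.card ≤ n := by
      rw [← Set.ncard_eq_toFinset_card _ hfin]
      have := Set.ncard_union_le α β
      omega
    have main := distortion_lower m hm r l hl hlr δ η (m * l / (2 * n)) hδ hδ2 (by positivity)
      hηρ hsep hfin.toFinset (by simpa using Or.inr hβne)
    rw [hfin.coe_toFinset] at main
    refine le_trans ?_ main
    have hc' : (hfin.toFinset.card : ℝ) ≤ n := by exact_mod_cast hc
    have : (hfin.toFinset.card : ℝ) * (4 * (m * l / (2 * n)) ^ 3 / (3 * (m * l)))
        ≤ n * (4 * (m * l / (2 * n)) ^ 3 / (3 * (m * l))) := by gcongr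
    refine le_trans (le_of_eq ?_) (sub_le_sub_left this _)
    field_simp
    ring

lemma ratio_tendsto (m : ℕ) (hm : 3 ≤ m) (b : ℕ) :
    Tendsto (fun n : ℕ => (n : ℝ) / (((n - b) / m : ℕ) : ℝ)) atTop (nhds (m : ℝ)) := by
  have hm0 : (0 : ℝ) < m := by positivity
  have h1 : Tendsto (fun n : ℕ => (((n - b) / m : ℕ) : ℝ) / n) atTop (nhds ((m : ℝ)⁻¹)) := by
    have lo : Tendsto (fun n : ℕ => (m : ℝ)⁻¹ - ((b + m : ℝ) / m) / n) atTop
        (nhds ((m : ℝ)⁻¹)) := by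
      simpa using (tendsto_const_nhds (x := (m : ℝ)⁻¹)).sub
        (tendsto_const_div_atTop_nhds_zero_nat ((b + m : ℝ) / m))
    refine tendsto_of_tendsto_of_tendsto_of_le_of_le' lo tendsto_const_nhds ?_ ?_
    · filter_upwards [eventually_gt_atTop 0] with n hn
      have hn' : (0 : ℝ) < n := by exact_mod_cast hn
      have key : n ≤ m * ((n - b) / m) + (b + m) := by
        have := Nat.lt_mul_div_succ (n - b) (show 0 < m by omega)
        rw [mul_add] at this
        omega
      have key' : (n : ℝ) ≤ m * (((n - b) / m : ℕ) : ℝ) + (b + m) := by exact_mod_cast key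
      rw [le_div_iff₀ hn', sub_mul, div_mul_cancel₀ _ hn'.ne', inv_mul_eq_div, ← sub_div,
        div_le_iff₀ hm0]
      linarith
    · filter_upwards [eventually_gt_atTop 0] with n hn
      have hn' : (0 : ℝ) < n := by exact_mod_cast hn
      have key : m * ((n - b) / m) ≤ n := (Nat.mul_div_le _ _).trans (Nat.sub_le _ _)
      have key' : m * (((n - b) / m : ℕ) : ℝ) ≤ n := by exact_mod_cast key
      rw [div_le_iff₀ hn', inv_mul_eq_div, le_div_iff₀ hm0]
      linarith
  have h2 := h1.inv₀ (inv_ne_zero hm0.ne')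
  simpa using h2

lemma quant_main (m : ℕ) (hm : 3 ≤ m) (r : ℝ) (hr : 0 < r) (β : Set (ℝ × ℝ)) (hβ : β.Finite)
    (hβne : β.Nonempty) :
    Tendsto (fun n : ℕ => (n : ℝ) ^ 2 * condQuantError2 (polyUniform m r) β n)
        atTop (nhds (1 / 3 * (m : ℝ) ^ 2 * r ^ 2 * Real.sin (Real.pi / m) ^ 2)) := by
  have hm0 : (0 : ℝ) < m := by positivity
  have hm3 : (3 : ℝ) ≤ m := by exact_mod_cast hm
  obtain ⟨l, hlr⟩ : ∃ l, l = 2 * r * Real.sin (Real.pi / m) := ⟨_, rfl⟩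
  have hsin : 0 < Real.sin (Real.pi / m) := by
    apply Real.sin_pos_of_pos_of_lt_pi (by positivity)
    exact div_lt_self Real.pi_pos (by linarith)
  have hl : 0 < l := by rw [hlr]; positivity
  have hval : 1 / 3 * (m : ℝ) ^ 2 * r ^ 2 * Real.sin (Real.pi / m) ^ 2 = (m * l) ^ 2 / 12 := by
    rw [hlr]; ring
  rw [hval]
  rw [tendsto_order]
  constructor
  · intro a ha
    obtain ⟨δ, ⟨hδ, hδ2⟩, hδa⟩ : ∃ δ : ℝ, (0 < δ ∧ δ < 1 / 2) ∧
        a < (m * l) ^ 2 * (1 / 12 - δ / 2) := by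
      have hcont : Tendsto (fun δ : ℝ => (m * l) ^ 2 * (1 / 12 - δ / 2))
          (nhdsWithin 0 (Set.Ioi 0)) (nhds ((m * l) ^ 2 / 12)) := by
        have : Continuous (fun δ : ℝ => (m * l) ^ 2 * (1 / 12 - δ / 2)) := by fun_prop
        have h := this.tendsto 0
        have e : (m * l) ^ 2 * (1 / 12 - (0:ℝ) / 2) = (m * l) ^ 2 / 12 := by ring
        rw [e] at h
        exact h.mono_left nhdsWithin_le_nhds
      obtain ⟨δ, h1, h2⟩ := ((hcont.eventually_const_lt ha).and
        (Ioo_mem_nhdsGT (show (0:ℝ) < 1 / 2 by norm_num))).exists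
      exact ⟨δ, h2, h1⟩
    obtain ⟨η, hη, hsep⟩ := edges_sep m hm r hr δ hδ hδ2
    have hlim : Tendsto (fun n : ℕ => 4 * ((m * l / 2) / (n:ℝ)) ^ 2) atTop (nhds 0) := by
      simpa using ((tendsto_const_div_atTop_nhds_zero_nat (m * l / 2)).pow 2).const_mul 4
    filter_upwards [hlim.eventually_lt_const hη, eventually_gt_atTop 0,
      eventually_ge_atTop β.ncard] with n h1 h2 h3
    have hn' : (0 : ℝ) < n := by exact_mod_cast h2
    have := quant_lower m hm r l hl hlr δ η hδ hδ2 hsep β hβ hβne n h3 h2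
      (by rw [← div_div]; exact h1.le)
    rw [div_le_iff₀ (by positivity)] at this
    linarith
  · intro a ha
    have hlim : Tendsto (fun n : ℕ => ((n : ℝ) / (((n - β.ncard) / m : ℕ) : ℝ)) ^ 2 * (l ^ 2 / 12))
        atTop (nhds ((m : ℝ) ^ 2 * (l ^ 2 / 12))) :=
      ((ratio_tendsto m hm β.ncard).pow 2).mul_const _
    have e : (m : ℝ) ^ 2 * (l ^ 2 / 12) = (m * l) ^ 2 / 12 := by ring
    rw [e] at hlim
    filter_upwards [hlim.eventually_lt_const ha, eventually_ge_atTop (β.ncard + m)] with n h1 h2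
    have hk : 0 < (n - β.ncard) / m := Nat.div_pos (by omega) (by omega)
    have := quant_upper m hm r n _ hk β hβ (Nat.mul_div_le _ _)
    rw [← hlr] at this
    refine lt_of_le_of_lt ?_ h1
    refine (mul_le_mul_of_nonneg_left this (sq_nonneg _)).trans (le_of_eq ?_)
    have hk' : (0:ℝ) < (((n - β.ncard) / m : ℕ) : ℝ) := by exact_mod_cast hk
    field_simp

/-- Theorem 4.6: the conditional quantization errors for the uniform distribution on the
boundary of the regular `m`-sided polygon (with conditional set the vertices) tend to `0`,
and the conditional quantization coefficient exists and equals `(1/3)m²r² sin²(π/m)`. -/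
theorem stmt18 (m : ℕ) (hm : 3 ≤ m) (r : ℝ) (hr : 0 < r) :
    Tendsto (fun n : ℕ => condQuantError2 (polyUniform m r) (vtx m r '' Set.Icc 1 m) n)
      atTop (nhds 0)
    ∧ Tendsto
        (fun n : ℕ => (n : ℝ) ^ 2 * condQuantError2 (polyUniform m r) (vtx m r '' Set.Icc 1 m) n)
        atTop (nhds (1 / 3 * (m : ℝ) ^ 2 * r ^ 2 * Real.sin (Real.pi / m) ^ 2)) := by
  have hβ : (vtx m r '' Set.Icc 1 m).Finite := (Set.finite_Icc 1 m).image _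
  have hne : (vtx m r '' Set.Icc 1 m).Nonempty := ⟨_, 1, ⟨le_rfl, by omega⟩, rfl⟩
  have h := quant_main m hm r hr _ hβ hne
  refine ⟨?_, h⟩
  have h2 : Tendsto (fun n : ℕ => ((1:ℝ) / n) ^ 2) atTop (nhds 0) := by
    simpa using (tendsto_const_div_atTop_nhds_zero_nat (1:ℝ)).pow 2
  have h3 := h2.mul h
  rw [zero_mul] at h3
  refine h3.congr' ?_
  filter_upwards [eventually_gt_atTop 0] with n hn
  have hn' : (0 : ℝ) < n := by exact_mod_cast hn
  field_simp
end
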